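/- (Main Theorem, Lp version) For probability densities f_1,…,f_k on R^n and p ∈ (1,∞]: ‖f_1 ⋆ f_2 ⋆ ⋯ ⋆ f_k‖_p ≤ ‖f_1* ⋆ f_2* ⋆ ⋯ ⋆ f_k*‖_p, where ⋆ denotes convolution. Equivalently, h_p(f_1 ⋆ ⋯ ⋆ f_k) ≥ h_p(f_1* ⋆ ⋯ ⋆ f_k*). -/

import Mathlib

open MeasureTheory Set Filter ENNReal

noncomputable section

/-- The spherically symmetric (decreasing) rearrangement of a set `A ⊆ ℝⁿ`:
the centered open ball with the same Lebesgue measure as `A`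
(empty if `A` is null, all of `ℝⁿ` if `A` has infinite measure). -/
def ballRearrange (n : ℕ) (A : Set (EuclideanSpace ℝ (Fin n))) :
    Set (EuclideanSpace ℝ (Fin n)) :=
  {x | volume (Metric.ball (0 : EuclideanSpace ℝ (Fin n)) ‖x‖) < volume A}

/-- The spherically symmetric decreasing rearrangement of a function:
`f*(y) = ∫₀^∞ 1{y ∈ {x : f x > t}*} dt`. -/
def symmRearr (n : ℕ) (f : EuclideanSpace ℝ (Fin n) → ℝ≥0∞) :
    EuclideanSpace ℝ (Fin n) → ℝ≥0∞ :=
  fun y => ∫⁻ t in Ioi (0 : ℝ), (ballRearrange n {x | ENNReal.ofReal t < f x}).indicator 1 y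

/-- `f` is a probability density on `ℝⁿ`. -/
def IsDensity (n : ℕ) (f : EuclideanSpace ℝ (Fin n) → ℝ≥0∞) : Prop :=
  Measurable f ∧ ∫⁻ x, f x = 1

/-- Integral of the positive part of `-f log f`. -/
def entPos (n : ℕ) (f : EuclideanSpace ℝ (Fin n) → ℝ≥0∞) : ℝ≥0∞ :=
  ∫⁻ x, ENNReal.ofReal (-((f x).toReal * Real.log (f x).toReal))

/-- Integral of the negative part of `-f log f`. -/
def entNeg (n : ℕ) (f : EuclideanSpace ℝ (Fin n) → ℝ≥0∞) : ℝ≥0∞ :=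
  ∫⁻ x, ENNReal.ofReal ((f x).toReal * Real.log (f x).toReal)

/-- The Shannon differential entropy `h(f) = -∫ f log f` is well defined. -/
def EntDefined (n : ℕ) (f : EuclideanSpace ℝ (Fin n) → ℝ≥0∞) : Prop :=
  entPos n f ≠ ⊤ ∨ entNeg n f ≠ ⊤

/-- The Shannon differential entropy as an extended real number. -/
def entropy (n : ℕ) (f : EuclideanSpace ℝ (Fin n) → ℝ≥0∞) : EReal :=
  (entPos n f : EReal) - (entNeg n f : EReal)

/-- The Rényi entropy of order `p ∈ (0,1) ∪ (1,∞)`: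
`h_p(f) = (1/(1-p)) log ∫ f^p`. -/
def renyi (n : ℕ) (f : EuclideanSpace ℝ (Fin n) → ℝ≥0∞) (p : ℝ) : EReal :=
  (((1 - p)⁻¹ : ℝ) : EReal) * ENNReal.log (∫⁻ x, f x ^ p)

/-- Convolution of two `ℝ≥0∞`-valued functions on `ℝⁿ`. -/
def conv2 (n : ℕ) (f g : EuclideanSpace ℝ (Fin n) → ℝ≥0∞) :
    EuclideanSpace ℝ (Fin n) → ℝ≥0∞ :=
  fun x => ∫⁻ y, f y * g (x - y)

/-- Iterated convolution of a (nonempty) list of functions. -/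
def convList (n : ℕ) : List (EuclideanSpace ℝ (Fin n) → ℝ≥0∞) →
    (EuclideanSpace ℝ (Fin n) → ℝ≥0∞)
  | [] => fun _ => 0
  | [f] => f
  | f :: g :: rest => conv2 n f (convList n (g :: rest))

/-- `f ≺ g`: `f` is majorized by `g`. -/
def Majorizes (n : ℕ) (f g : EuclideanSpace ℝ (Fin n) → ℝ≥0∞) : Prop :=
  ∀ r : ℝ, 0 < r →
    ∫⁻ x in Metric.ball (0 : EuclideanSpace ℝ (Fin n)) r, symmRearr n f x ≤
      ∫⁻ x in Metric.ball (0 : EuclideanSpace ℝ (Fin n)) r, symmRearr n g x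

/-- The measure of the pairs in `B × C` whose sum lies in `A`. -/
def addTriple {G : Type*} [Add G] [MeasureSpace G] (A B C : Set G) : ℝ≥0∞ :=
  (volume : Measure (G × G)) {p | p.1 ∈ B ∧ p.2 ∈ C ∧ p.1 + p.2 ∈ A}

lemma addTriple_mono {G : Type*} [Add G] [MeasureSpace G] {A B C A' B' C' : Set G}
    (hA : A ⊆ A') (hB : B ⊆ B') (hC : C ⊆ C') :
    addTriple A B C ≤ addTriple A' B' C' :=
  measure_mono fun _ hp => ⟨hB hp.1, hC hp.2.1, hA hp.2.2⟩

lemma addTriple_le_mul_right {G : Type*} [Add G] [MeasureSpace G] [SFinite (volume : Measure G)]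
    {A B C : Set G} : addTriple A B C ≤ volume B * volume C := by
  rw [addTriple, Measure.volume_eq_prod, ← Measure.prod_prod]
  exact measure_mono fun p hp => ⟨hp.1, hp.2.1⟩

lemma addTriple_comm {G : Type*} [AddCommGroup G] [MeasureSpace G]
    [SFinite (volume : Measure G)] {A B C : Set G} : addTriple A B C = addTriple A C B := by
  have hmp : MeasurePreserving (MeasurableEquiv.prodComm : G × G ≃ᵐ G × G) volume volume :=
    Measure.measurePreserving_swap
  rw [addTriple, addTriple, ← hmp.measure_preimage_equiv]
  congr 1
  ext p
  change (p.2 ∈ B ∧ p.1 ∈ C ∧ p.2 + p.1 ∈ A) ↔ _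
  rw [add_comm]
  simp [and_left_comm]

section AddTriple

variable {G : Type*} [AddCommGroup G] [MeasureSpace G] [MeasurableAdd₂ G] [MeasurableNeg G]
  [SFinite (volume : Measure G)] [(volume : Measure G).IsAddLeftInvariant]
  {A B C A' B' C' : Set G}

lemma addTriple_eq_setLIntegral (hA : MeasurableSet A) (hB : MeasurableSet B)
    (hC : MeasurableSet C) :
    addTriple A B C = ∫⁻ x in A, volume {y | y ∈ B ∧ x - y ∈ C} := by
  have hmp := measurePreserving_prod_sub_swap (volume : Measure G) (volume : Measure G)
  have hS : MeasurableSet {p : G × G | p.1 ∈ B ∧ p.2 ∈ C ∧ p.1 + p.2 ∈ A} :=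
    (measurable_fst hB).inter ((measurable_snd hC).inter (measurable_add hA))
  have h := hmp.measure_preimage hS.nullMeasurableSet
  rw [addTriple, Measure.volume_eq_prod, ← h,
    Measure.prod_apply (hmp.measurable hS), ← lintegral_indicator hA]
  refine lintegral_congr fun x => ?_
  by_cases hx : x ∈ A <;> simp [preimage, hx]

lemma addTriple_le_mul_left (hA : MeasurableSet A) (hB : MeasurableSet B)
    (hC : MeasurableSet C) :
    addTriple A B C ≤ volume A * volume B := by
  rw [addTriple_eq_setLIntegral hA hB hC]
  calc ∫⁻ x in A, volume {y | y ∈ B ∧ x - y ∈ C} ≤ ∫⁻ x in A, volume B :=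
        lintegral_mono fun x => measure_mono fun y hy => hy.1
    _ = volume A * volume B := by rw [setLIntegral_const, mul_comm]

lemma addTriple_le_mul_left' (hA : MeasurableSet A) (hB : MeasurableSet B)
    (hC : MeasurableSet C) :
    addTriple A B C ≤ volume A * volume C := by
  rw [addTriple_comm]
  exact addTriple_le_mul_left hA hC hB

lemma addTriple_le_add_diff (hA : MeasurableSet A) (hB : MeasurableSet B) (hC : MeasurableSet C)
    (hA' : MeasurableSet A') :
    addTriple A B C ≤ addTriple A' B' C' + volume (A \ A') * volume B +
      volume (B \ B') * volume C + volume (C \ C') * volume B := by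
  have key : addTriple A B C ≤ addTriple A' B' C' + addTriple (A \ A') B C +
      addTriple A (B \ B') C + addTriple A B (C \ C') := by
    refine le_trans (measure_mono ?_) ((measure_union_le _ _).trans (add_le_add
      ((measure_union_le _ _).trans (add_le_add (measure_union_le _ _) le_rfl)) le_rfl))
    rintro p ⟨h1, h2, h3⟩
    by_cases g1 : p.1 ∈ B' <;> by_cases g2 : p.2 ∈ C' <;> by_cases g3 : p.1 + p.2 ∈ A' <;>
      simp [*]
  refine key.trans ?_
  gcongr
  · exact addTriple_le_mul_left (hA.diff hA') hB hC
  · exact addTriple_le_mul_right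
  · rw [addTriple_comm]; exact addTriple_le_mul_right

end AddTriple

section Line

lemma measurable_volume_inter_Iic (D : Set ℝ) : Measurable fun y => volume (D ∩ Iic y) :=
  Monotone.measurable fun _ _ h => measure_mono (inter_subset_inter_right _ (Iic_subset_Iic.2 h))

lemma measurable_volume_inter_Ici (D : Set ℝ) : Measurable fun y => volume (D ∩ Ici y) :=
  Antitone.measurable fun _ _ h => measure_mono (inter_subset_inter_right _ (Ici_subset_Ici.2 h))

lemma volume_inter_volume_Iic_lt_le {D : Set ℝ} (hD : MeasurableSet D) (t : ℝ≥0∞) :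
    volume (D ∩ {y | volume (D ∩ Iic y) < t}) ≤ t := by
  have hm : MeasurableSet (D ∩ {y | volume (D ∩ Iic y) < t}) :=
    hD.inter (measurableSet_lt (measurable_volume_inter_Iic D) measurable_const)
  rw [hm.measure_eq_iSup_isCompact]
  refine iSup₂_le fun K hK => iSup_le fun hKc => ?_
  rcases K.eq_empty_or_nonempty with rfl | hne
  · simp
  obtain ⟨k, hk, hkmax⟩ := hKc.exists_isGreatest hne
  exact (measure_mono (t := D ∩ Iic k) fun y hy => ⟨(hK hy).1, hkmax hy⟩).trans (hK hk).2.le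

lemma volume_inter_le_volume_Iic_add_le {D : Set ℝ} (hD : MeasurableSet D) {t : ℝ≥0∞}
    (ht : t ≤ volume D) (hfin : t ≠ ⊤) :
    volume (D ∩ {y | t ≤ volume (D ∩ Iic y)}) + t ≤ volume D := by
  have hm : MeasurableSet (D ∩ {y | t ≤ volume (D ∩ Iic y)}) :=
    hD.inter (measurableSet_le measurable_const (measurable_volume_inter_Iic D))
  suffices volume (D ∩ {y | t ≤ volume (D ∩ Iic y)}) ≤ volume D - t from
    (add_le_add_left this t).trans (tsub_add_cancel_of_le ht).le
  rw [hm.measure_eq_iSup_isCompact]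
  refine iSup₂_le fun K hK => iSup_le fun hKc => ?_
  rcases K.eq_empty_or_nonempty with rfl | hne
  · simp
  obtain ⟨k, hk, hkmin⟩ := hKc.exists_isLeast hne
  refine ENNReal.le_sub_of_add_le_right hfin ?_
  have hIio : volume (D ∩ Iic k) = volume (D ∩ Iio k) :=
    measure_congr ((ae_eq_refl D).inter Iio_ae_eq_Iic.symm)
  calc volume K + t ≤ volume (D \ Iio k) + volume (D ∩ Iio k) := by
        gcongr
        · exact fun y hy => ⟨(hK hy).1, not_lt.2 (hkmin hy)⟩
        · exact (hK hk).2.trans hIio.le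
    _ = volume D := by rw [add_comm, measure_inter_add_sdiff _ measurableSet_Iio]

lemma volume_inter_le_volume_Ici_add_le {D : Set ℝ} (hD : MeasurableSet D) {t : ℝ≥0∞}
    (ht : t ≤ volume D) (hfin : t ≠ ⊤) :
    volume (D ∩ {y | t ≤ volume (D ∩ Ici y)}) + t ≤ volume D := by
  have hneg : MeasurableSet (-D) := hD.neg
  have h := volume_inter_le_volume_Iic_add_le hneg (t := t) (by simpa using ht) hfin
  rw [Measure.measure_neg] at h
  refine le_trans (le_of_eq ?_) h
  congr 1
  rw [← Measure.measure_neg]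
  congr 1
  ext y
  have : -D ∩ Iic y = -(D ∩ Ici (-y)) := by
    ext z
    simp only [mem_inter_iff, Set.mem_neg, mem_Iic, mem_Ici, neg_le_neg_iff]
  simp only [Set.mem_neg, mem_inter_iff, mem_ofPred_eq, this, Measure.measure_neg]

/-- A continuous form of Pollard's inequality. -/
lemma mul_le_lintegral_min_add {B C : Set ℝ} (hB : MeasurableSet B) (hC : MeasurableSet C)
    {t : ℝ≥0∞} (htB : t ≤ volume B) (htC : t ≤ volume C) (ht : t ≠ ⊤) :
    volume B * volume C ≤ (∫⁻ x, min (volume {y | y ∈ B ∧ x - y ∈ C}) t) +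
      (volume B - t) * (volume C - t) := by
  set α : ℝ → ℝ≥0∞ := fun y => volume (B ∩ Iic y)
  set γ : ℝ → ℝ≥0∞ := fun z => volume (C ∩ Ici z)
  have hα : Measurable α := measurable_volume_inter_Iic B
  have hγ : Measurable γ := measurable_volume_inter_Ici C
  set L : Set (ℝ × ℝ) := {p | p.1 ∈ B ∧ p.2 ∈ C ∧ (α p.1 < t ∨ γ p.2 < t)}
  have hL : MeasurableSet L :=
    (measurable_fst hB).inter ((measurable_snd hC).inter
      ((measurableSet_lt (hα.comp measurable_fst) measurable_const).union
        (measurableSet_lt (hγ.comp measurable_snd) measurable_const)))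
  have hcover : volume B * volume C ≤ volume L +
      volume (B ∩ {y | t ≤ α y}) * volume (C ∩ {z | t ≤ γ z}) := by
    rw [← Measure.prod_prod, ← Measure.prod_prod, ← Measure.volume_eq_prod]
    refine le_trans (measure_mono ?_) (measure_union_le _ _)
    rintro ⟨y, z⟩ ⟨hy, hz⟩
    by_cases h1 : α y < t
    · exact Or.inl ⟨hy, hz, Or.inl h1⟩
    by_cases h2 : γ z < t
    · exact Or.inl ⟨hy, hz, Or.inr h2⟩
    exact Or.inr ⟨⟨hy, not_lt.1 h1⟩, ⟨hz, not_lt.1 h2⟩⟩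
  refine hcover.trans (add_le_add ?_ (mul_le_mul' ?_ ?_))
  · have hmp := measurePreserving_prod_sub_swap (volume : Measure ℝ) (volume : Measure ℝ)
    rw [Measure.volume_eq_prod, ← hmp.measure_preimage hL.nullMeasurableSet,
      Measure.prod_apply (hmp.measurable hL)]
    refine lintegral_mono fun x => le_min (measure_mono fun y hy => ⟨hy.1, hy.2.1⟩) ?_
    set D : Set ℝ := {y | y ∈ B ∧ x - y ∈ C}
    have hD : MeasurableSet D := hB.inter ((measurable_const.sub measurable_id) hC)
    refine le_trans (measure_mono ?_) (volume_inter_volume_Iic_lt_le hD t)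
    rintro y ⟨hy1, hy2, hy3⟩
    refine ⟨⟨hy1, hy2⟩, ?_⟩
    rcases hy3 with h | h
    · exact lt_of_le_of_lt (measure_mono (t := B ∩ Iic y) fun w hw => ⟨hw.1.1, hw.2⟩) h
    · refine lt_of_le_of_lt ?_ h
      change _ ≤ volume (C ∩ Ici (x - y))
      rw [← (Measure.measurePreserving_sub_left volume x).measure_preimage
        (hC.inter measurableSet_Ici).nullMeasurableSet]
      refine measure_mono fun w hw => ⟨hw.1.2, ?_⟩
      have : w ≤ y := hw.2
      exact sub_le_sub_left this x
  · exact ENNReal.le_sub_of_add_le_right ht (volume_inter_le_volume_Iic_add_le hB htB ht)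
  · exact ENNReal.le_sub_of_add_le_right ht (volume_inter_le_volume_Ici_add_le hC htC ht)

lemma addTriple_add_mul_le {A B C : Set ℝ} (hA : MeasurableSet A) (hB : MeasurableSet B)
    (hC : MeasurableSet C) (hBt : volume B ≠ ⊤) (hCt : volume C ≠ ⊤)
    {t : ℝ≥0∞} (htB : t ≤ volume B) (htC : t ≤ volume C) :
    addTriple A B C ≤ t * volume A + (volume B - t) * (volume C - t) := by
  have ht : t ≠ ⊤ := ne_top_of_le_ne_top hBt htB
  set r : ℝ → ℝ≥0∞ := fun x => volume {y | y ∈ B ∧ x - y ∈ C}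
  have hr : Measurable r := by
    refine measurable_measure_prodMk_left (s := {p : ℝ × ℝ | p.2 ∈ B ∧ p.1 - p.2 ∈ C}) ?_
    exact (measurable_snd hB).inter (measurable_sub hC)
  have htot : ∫⁻ x, r x = volume B * volume C := by
    have h := addTriple_eq_setLIntegral (A := univ) MeasurableSet.univ hB hC
    rw [setLIntegral_univ] at h
    rw [← h, addTriple, ← Measure.prod_prod, Measure.volume_eq_prod]
    congr 1
    ext p; simp
  have hsplit : (∫⁻ x, min (r x) t) + ∫⁻ x, (r x - t) = volume B * volume C := by
    rw [← htot, ← lintegral_add_left (hr.min measurable_const)]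
    refine lintegral_congr fun x => ?_
    rcases le_total (r x) t with h | h
    · simp [h, tsub_eq_zero_of_le h]
    · simp [h]
  have hmin : ∫⁻ x, min (r x) t ≠ ⊤ :=
    ne_top_of_le_ne_top (ENNReal.mul_ne_top hBt hCt) (hsplit ▸ le_self_add)
  have hexc : ∫⁻ x, (r x - t) ≤ (volume B - t) * (volume C - t) := by
    have := mul_le_lintegral_min_add hB hC htB htC ht
    rw [← hsplit] at this
    exact (ENNReal.add_le_add_iff_left hmin).1 this
  rw [addTriple_eq_setLIntegral hA hB hC]
  calc ∫⁻ x in A, r x ≤ ∫⁻ x in A, (t + (r x - t)) :=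
        lintegral_mono fun x => le_add_tsub
    _ = t * volume A + ∫⁻ x in A, (r x - t) := by
        rw [lintegral_add_left measurable_const, setLIntegral_const]
    _ ≤ _ := by gcongr; exact (setLIntegral_le_lintegral _ _).trans hexc

lemma volume_two_mul_abs_lt (a : ℝ) : volume {t : ℝ | 2 * |t| < a} = ENNReal.ofReal a := by
  have : {t : ℝ | 2 * |t| < a} = Ioo (-(a / 2)) (a / 2) := by
    ext t
    simp only [mem_ofPred_eq, mem_Ioo, ← abs_lt]
    constructor <;> intro h <;> linarith
  rw [this, Real.volume_Ioo]
  congr 1; ring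

lemma measurableSet_two_mul_abs_lt (a : ℝ) : MeasurableSet {t : ℝ | 2 * |t| < a} :=
  measurableSet_lt (by fun_prop) measurable_const

lemma volume_triangle_le {a b c : ℝ} (h : a ≤ b + c) :
    volume {p : ℝ × ℝ | p.1 < b ∧ p.2 < c ∧ a ≤ p.1 + p.2} ≤
      ENNReal.ofReal ((b + c - a) ^ 2 / 2) := by
  have hm : MeasurableSet {p : ℝ × ℝ | p.1 < b ∧ p.2 < c ∧ a ≤ p.1 + p.2} :=
    (measurableSet_lt measurable_fst measurable_const).inter
      ((measurableSet_lt measurable_snd measurable_const).inter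
        (measurableSet_le measurable_const (measurable_fst.add measurable_snd)))
  rw [Measure.volume_eq_prod, Measure.prod_apply hm]
  have hle : ∀ x : ℝ, volume (Prod.mk x ⁻¹' {p : ℝ × ℝ | p.1 < b ∧ p.2 < c ∧ a ≤ p.1 + p.2}) ≤
      (Ioc (a - c) b).indicator (fun x => ENNReal.ofReal (c - (a - x))) x := by
    intro x
    by_cases hx : x ∈ Ioc (a - c) b
    · rw [indicator_of_mem hx, ← Real.volume_Ico]
      refine measure_mono fun z hz => ⟨?_, hz.2.1⟩
      have : a ≤ x + z := hz.2.2
      linarith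
    · rw [indicator_of_notMem hx, nonpos_iff_eq_zero, ← measure_empty (μ := (volume : Measure ℝ))]
      congr 1
      refine eq_empty_iff_forall_notMem.2 fun z hz => hx ?_
      obtain ⟨h1, h2, h3⟩ := hz
      simp only at h1 h2 h3
      constructor <;> linarith
  refine (lintegral_mono hle).trans (le_of_eq ?_)
  rw [lintegral_indicator measurableSet_Ioc,
    ← ofReal_integral_eq_lintegral_ofReal]
  · rw [← intervalIntegral.integral_of_le (by linarith)]
    congr 1
    have : ∀ x : ℝ, c - (a - x) = (c - a) + x := fun x => by ring
    simp only [this]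
    rw [intervalIntegral.integral_add (by simp) (by simp), intervalIntegral.integral_const,
      integral_id, smul_eq_mul]
    ring
  · exact (by fun_prop : Continuous fun x : ℝ => c - (a - x)).integrableOn_Ioc
  · filter_upwards [ae_restrict_mem measurableSet_Ioc] with x hx
    have := hx.1
    simp only [Pi.zero_apply]
    linarith

/-- The Riesz rearrangement inequality for sets on the real line. -/
lemma addTriple_le_of_volume_eq {A B C : Set ℝ} (hA : MeasurableSet A) (hB : MeasurableSet B)
    (hC : MeasurableSet C) {a b c : ℝ} (ha : 0 ≤ a) (hb : 0 ≤ b)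
    (hvA : volume A = ENNReal.ofReal a) (hvB : volume B = ENNReal.ofReal b)
    (hvC : volume C = ENNReal.ofReal c) :
    addTriple A B C ≤
      addTriple {t : ℝ | 2 * |t| < a} {t : ℝ | 2 * |t| < b} {t : ℝ | 2 * |t| < c} := by
  have hIa := measurableSet_two_mul_abs_lt a
  have hIb := measurableSet_two_mul_abs_lt b
  have hIc := measurableSet_two_mul_abs_lt c
  set I : ℝ → Set ℝ := fun a => {t : ℝ | 2 * |t| < a}
  have hvol : ∀ a, volume (I a) = ENNReal.ofReal a := volume_two_mul_abs_lt
  change addTriple A B C ≤ addTriple (I a) (I b) (I c)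
  have hprod : volume (I b ×ˢ I c) = ENNReal.ofReal b * ENNReal.ofReal c := by
    rw [Measure.volume_eq_prod, Measure.prod_prod, hvol, hvol]
  rcases le_total (b + c) a with h1 | h1
  · refine addTriple_le_mul_right.trans ?_
    rw [hvB, hvC, ← hprod]
    refine measure_mono fun p hp => ⟨hp.1, hp.2, ?_⟩
    have h2 : 2 * |p.1| < b := hp.1
    have h3 : 2 * |p.2| < c := hp.2
    have := abs_add_le p.1 p.2
    change 2 * |p.1 + p.2| < a
    linarith
  have hprodmk : ∀ d, ∀ S : Set ℝ, MeasurableSet S → (∀ x ∈ I a, ∀ y ∈ I d, x - y ∈ S) →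
      ENNReal.ofReal a * ENNReal.ofReal d ≤ addTriple (I a) (I d) S := by
    intro d S hS h
    rw [addTriple_eq_setLIntegral hIa (measurableSet_two_mul_abs_lt d) hS, mul_comm, ← hvol a,
      ← hvol d, ← setLIntegral_const]
    refine setLIntegral_mono' hIa fun x hx => ?_
    exact measure_mono fun y hy => ⟨hy, h x hx y hy⟩
  rcases le_total (a + b) c with h2 | h2
  · refine (addTriple_le_mul_left hA hB hC).trans ?_
    rw [hvA, hvB]
    refine hprodmk b _ hIc fun x hx y hy => ?_
    have h2 : 2 * |x| < a := hx
    have h3 : 2 * |y| < b := hy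
    have := abs_sub x y
    change 2 * |x - y| < c
    linarith
  rcases le_total (a + c) b with h3 | h3
  · refine (addTriple_le_mul_left' hA hB hC).trans ?_
    rw [hvA, hvC, addTriple_comm]
    refine hprodmk c _ hIb fun x hx y hy => ?_
    have h2 : 2 * |x| < a := hx
    have h3 : 2 * |y| < c := hy
    have := abs_sub x y
    change 2 * |x - y| < b
    linarith
  set t := (b + c - a) / 2 with ht
  have ht0 : 0 ≤ t := by linarith
  have hup := addTriple_add_mul_le hA hB hC (hvB ▸ ofReal_ne_top) (hvC ▸ ofReal_ne_top)
    (t := ENNReal.ofReal t) (by rw [hvB]; exact ofReal_le_ofReal (by linarith))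
    (by rw [hvC]; exact ofReal_le_ofReal (by linarith))
  rw [hvA, hvB, hvC, ← ofReal_sub _ ht0, ← ofReal_sub _ ht0, ← ofReal_mul ht0,
    ← ofReal_mul (by linarith), ← ofReal_add (by positivity)
    (mul_nonneg (by linarith) (by linarith))] at hup
  have hlow : ENNReal.ofReal b * ENNReal.ofReal c ≤
      addTriple (I a) (I b) (I c) + (ENNReal.ofReal (t ^ 2 / 2) + ENNReal.ofReal (t ^ 2 / 2)) := by
    have htri := volume_triangle_le (a := a / 2) (b := b / 2) (c := c / 2) (by linarith)
    rw [show b / 2 + c / 2 - a / 2 = t by rw [ht]; ring] at htri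
    set T := {p : ℝ × ℝ | p.1 < b / 2 ∧ p.2 < c / 2 ∧ a / 2 ≤ p.1 + p.2}
    have hneg : volume (-T) = volume T := Measure.measure_neg _ _
    rw [← hprod]
    refine le_trans (measure_mono ?_) ((measure_union_le _ (T ∪ -T)).trans
      (add_le_add le_rfl ((measure_union_le _ _).trans (add_le_add htri (hneg.trans_le htri)))))
    rintro ⟨y, z⟩ ⟨hy, hz⟩
    have hy' : 2 * |y| < b := hy
    have hz' : 2 * |z| < c := hz
    by_cases hyz : 2 * |y + z| < a
    · exact Or.inl ⟨hy, hz, hyz⟩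
    right
    have g1 := le_abs_self y
    have g2 := le_abs_self z
    have g3 := neg_abs_le y
    have g4 := neg_abs_le z
    rcases le_total 0 (y + z) with h | h
    · left
      rw [abs_of_nonneg h] at hyz
      refine ⟨?_, ?_, ?_⟩ <;> simp only <;> linarith
    · right
      rw [abs_of_nonpos h] at hyz
      refine ⟨?_, ?_, ?_⟩ <;> simp only [Prod.fst_neg, Prod.snd_neg] <;> linarith
  rw [← ofReal_add (by positivity) (by positivity), ← ofReal_mul hb] at hlow
  refine hup.trans ?_
  have : ENNReal.ofReal (t * a + (b - t) * (c - t)) + ENNReal.ofReal (t ^ 2 / 2 + t ^ 2 / 2) =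
      ENNReal.ofReal (b * c) := by
    rw [← ofReal_add (add_nonneg (by positivity) (mul_nonneg (by linarith) (by linarith)))
      (by positivity)]
    congr 1
    rw [show a = b + c - 2 * t by rw [ht]; ring]
    ring
  rw [← this] at hlow
  exact (ENNReal.add_le_add_iff_right ofReal_ne_top).1 hlow

/-- The centered open interval of the same length as `P`. -/
def intervalRearrange (P : Set ℝ) : Set ℝ := {t | ENNReal.ofReal (2 * |t|) < volume P}

lemma intervalRearrange_eq {P : Set ℝ} (hP : volume P ≠ ⊤) :
    intervalRearrange P = {t | 2 * |t| < (volume P).toReal} := by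
  ext t
  rw [intervalRearrange, mem_ofPred_eq, mem_ofPred_eq,
    ENNReal.ofReal_lt_iff_lt_toReal (by positivity) hP]

lemma volume_intervalRearrange {P : Set ℝ} (hP : volume P ≠ ⊤) :
    volume (intervalRearrange P) = volume P := by
  rw [intervalRearrange_eq hP, volume_two_mul_abs_lt, ofReal_toReal hP]

lemma addTriple_le_intervalRearrange {A B C : Set ℝ} (hA : MeasurableSet A) (hB : MeasurableSet B)
    (hC : MeasurableSet C) (hA' : volume A ≠ ⊤) (hB' : volume B ≠ ⊤) (hC' : volume C ≠ ⊤) :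
    addTriple A B C ≤
      addTriple (intervalRearrange A) (intervalRearrange B) (intervalRearrange C) := by
  rw [intervalRearrange_eq hA', intervalRearrange_eq hB', intervalRearrange_eq hC']
  exact addTriple_le_of_volume_eq hA hB hC toReal_nonneg toReal_nonneg
    (ofReal_toReal hA').symm (ofReal_toReal hB').symm (ofReal_toReal hC').symm

end Line

/-- Volume preserving additive coordinates `ℝ × Y ≃ E` in which the norm is
`‖Φ (t, y)‖² = t² + N y`. -/
structure LineCoords (Y E : Type*) [AddCommGroup Y] [MeasureSpace Y] [NormedAddCommGroup E]
    [MeasureSpace E] where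
  toEquiv : ℝ × Y ≃ᵐ E
  measurePreserving : MeasurePreserving toEquiv volume volume
  map_add : ∀ p q, toEquiv (p + q) = toEquiv p + toEquiv q
  sqNorm : Y → ℝ
  norm_sq : ∀ p, ‖toEquiv p‖ ^ 2 = p.1 ^ 2 + sqNorm p.2

lemma exists_lineCoords {m : ℕ} {u : EuclideanSpace ℝ (Fin (m + 1))} :
    ∃ (Φ : LineCoords (Fin m → ℝ) (EuclideanSpace ℝ (Fin (m + 1)))) (s : ℝ),
      Φ.toEquiv (s, 0) = u := by
  set e : EuclideanSpace ℝ (Fin (m + 1)) := EuclideanSpace.single 0 ‖u‖ with he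
  have hnorm : ‖e‖ = ‖u‖ := by simp [he]
  set T := (ℝ ∙ (e - u))ᗮ.reflection with hT
  have hTe : T e = u := Submodule.reflection_sub hnorm
  have h1 := (volume_preserving_piFinSuccAbove (fun _ : Fin (m + 1) => ℝ) 0).symm
  have h2 := PiLp.volume_preserving_toLp (Fin (m + 1))
  have h3 := T.measurePreserving
  let Ψ : ℝ × (Fin m → ℝ) ≃ᵐ EuclideanSpace ℝ (Fin (m + 1)) :=
    ((MeasurableEquiv.piFinSuccAbove (fun _ : Fin (m + 1) => ℝ) 0).symm.trans
      (MeasurableEquiv.toLp 2 (Fin (m + 1) → ℝ))).trans T.toHomeomorph.toMeasurableEquiv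
  have hΨ : ∀ p, Ψ p = T (WithLp.toLp 2 (Fin.cons p.1 p.2 : Fin (m + 1) → ℝ)) := by
    intro p
    simp [Ψ, MeasurableEquiv.piFinSuccAbove, Fin.insertNthEquiv]
  refine ⟨⟨Ψ, h3.comp (h2.comp h1), fun p q => ?_, fun y => ∑ i, y i ^ 2, fun p => ?_⟩, ‖u‖, ?_⟩
  · rw [hΨ, hΨ, hΨ, ← _root_.map_add]
    congr 1
    ext i
    refine Fin.cases ?_ (fun i => ?_) i <;> simp
  · rw [hΨ, LinearIsometryEquiv.norm_map, EuclideanSpace.norm_sq_eq, Fin.sum_univ_succ]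
    simp
  · change Ψ _ = _
    rw [hΨ, ← hTe]
    congr 1
    ext i
    refine Fin.cases ?_ (fun i => ?_) i <;> simp [he]

namespace LineCoords

variable {Y E : Type*} [AddCommGroup Y] [MeasureSpace Y] [NormedAddCommGroup E]
  [MeasureSpace E] (Φ : LineCoords Y E) {A B C : Set E}

/-- The section of `A` along the line through `y`. -/
def line (A : Set E) (y : Y) : Set ℝ := {t | Φ.toEquiv (t, y) ∈ A}

/-- The Steiner symmetrization of `A` in the direction of the first coordinate. -/
def steiner (A : Set E) : Set E :=
  {x | (Φ.toEquiv.symm x).1 ∈ intervalRearrange (Φ.line A (Φ.toEquiv.symm x).2)}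

lemma line_steiner (A : Set E) (y : Y) :
    Φ.line (Φ.steiner A) y = intervalRearrange (Φ.line A y) := by
  ext t
  simp [line, steiner]

lemma measurableSet_line (hA : MeasurableSet A) (y : Y) : MeasurableSet (Φ.line A y) :=
  (Φ.toEquiv.measurable.comp measurable_prodMk_right) hA

lemma steiner_mono (h : A ⊆ B) : Φ.steiner A ⊆ Φ.steiner B :=
  fun x hx => lt_of_lt_of_le (show ENNReal.ofReal _ < _ from hx)
    (measure_mono (t := Φ.line B (Φ.toEquiv.symm x).2) fun _ ht => h ht)

lemma line_ball (R : ℝ) (y : Y) :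
    Φ.line (Metric.ball 0 R) y =
      {t | 2 * |t| < if 0 < R then 2 * √(R ^ 2 - Φ.sqNorm y) else 0} := by
  ext t
  simp only [line, mem_ofPred_eq, mem_ball_zero_iff]
  split_ifs with hR
  · rw [← sq_lt_sq₀ (norm_nonneg _) hR.le, Φ.norm_sq, mul_lt_mul_iff_right₀ two_pos,
      Real.lt_sqrt (abs_nonneg t), sq_abs]
    exact ⟨fun h => by linarith, fun h => by linarith⟩
  · constructor
    · intro h
      exact absurd ((norm_nonneg _).trans_lt h) hR
    · intro h
      have := abs_nonneg t
      linarith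

lemma volume_line_ne_top {R : ℝ} (hA : A ⊆ Metric.ball 0 R) (y : Y) :
    volume (Φ.line A y) ≠ ⊤ := by
  refine ne_top_of_le_ne_top ?_ (measure_mono (t := Φ.line (Metric.ball 0 R) y) fun t ht => hA ht)
  rw [line_ball, volume_two_mul_abs_lt]
  exact ofReal_ne_top

lemma intervalRearrange_line_ball (R : ℝ) (y : Y) :
    intervalRearrange (Φ.line (Metric.ball 0 R) y) = Φ.line (Metric.ball 0 R) y := by
  rw [intervalRearrange_eq (Φ.volume_line_ne_top Subset.rfl y), line_ball, volume_two_mul_abs_lt,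
    toReal_ofReal (by split_ifs <;> positivity)]

lemma steiner_ball (R : ℝ) : Φ.steiner (Metric.ball 0 R) = Metric.ball 0 R := by
  ext x
  obtain ⟨p, rfl⟩ := Φ.toEquiv.surjective x
  change _ ↔ p.1 ∈ Φ.line (Metric.ball 0 R) p.2
  rw [← intervalRearrange_line_ball]
  simp [steiner]

lemma steiner_subset_ball {R : ℝ} (h : A ⊆ Metric.ball 0 R) :
    Φ.steiner A ⊆ Metric.ball 0 R :=
  (Φ.steiner_mono h).trans (Φ.steiner_ball R).subset

lemma measurable_volume_line (hA : MeasurableSet A) :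
    Measurable fun y => volume (Φ.line A y) :=
  measurable_measure_prodMk_right (Φ.toEquiv.measurable hA)

lemma measurableSet_steiner (hA : MeasurableSet A) : MeasurableSet (Φ.steiner A) := by
  have hm := Φ.measurable_volume_line hA
  have h1 : Measurable fun x => ENNReal.ofReal (2 * |(Φ.toEquiv.symm x).1|) := by
    have := Φ.toEquiv.symm.measurable
    fun_prop
  exact measurableSet_lt h1 (hm.comp (measurable_snd.comp Φ.toEquiv.symm.measurable))

variable [SFinite (volume : Measure Y)]

lemma volume_eq_lintegral_line (hA : MeasurableSet A) :
    volume A = ∫⁻ y, volume (Φ.line A y) := by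
  rw [← Φ.measurePreserving.measure_preimage_equiv, Measure.volume_eq_prod,
    Measure.prod_apply_symm (Φ.toEquiv.measurable hA)]
  rfl

lemma volume_steiner (hA : MeasurableSet A) (hfin : ∀ y, volume (Φ.line A y) ≠ ⊤) :
    volume (Φ.steiner A) = volume A := by
  rw [Φ.volume_eq_lintegral_line hA, Φ.volume_eq_lintegral_line (Φ.measurableSet_steiner hA)]
  refine lintegral_congr fun y => ?_
  rw [line_steiner, volume_intervalRearrange (hfin y)]

lemma addTriple_eq_lintegral_line [MeasurableAdd₂ E] (hA : MeasurableSet A) (hB : MeasurableSet B)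
    (hC : MeasurableSet C) :
    addTriple A B C = ∫⁻ y, ∫⁻ z,
      addTriple (Φ.line A (y + z)) (Φ.line B y) (Φ.line C z) := by
  have hS : MeasurableSet {p : E × E | p.1 ∈ B ∧ p.2 ∈ C ∧ p.1 + p.2 ∈ A} :=
    (measurable_fst hB).inter ((measurable_snd hC).inter (measurable_add hA))
  have : SFinite (volume : Measure E) := by
    rw [← Φ.measurePreserving.map_eq]; infer_instance
  have hmp : MeasurePreserving (Φ.toEquiv.prodCongr Φ.toEquiv) volume volume :=
    Φ.measurePreserving.prod Φ.measurePreserving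
  rw [addTriple, ← hmp.measure_preimage_equiv]
  set S : Set ((ℝ × Y) × (ℝ × Y)) :=
    Φ.toEquiv.prodCongr Φ.toEquiv ⁻¹' {p | p.1 ∈ B ∧ p.2 ∈ C ∧ p.1 + p.2 ∈ A}
  have hS' : MeasurableSet S := hmp.measurable hS
  have hf : Measurable (S.indicator (1 : (ℝ × Y) × (ℝ × Y) → ℝ≥0∞)) := measurable_one.indicator hS'
  rw [← lintegral_indicator_one hS', Measure.volume_eq_prod, lintegral_prod _ hf.aemeasurable,
    Measure.volume_eq_prod, lintegral_prod_symm' _ hf.lintegral_prod_right']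
  refine lintegral_congr fun y => ?_
  have h1 : ∀ t : ℝ, ∫⁻ q, S.indicator (1 : (ℝ × Y) × (ℝ × Y) → ℝ≥0∞) ((t, y), q)
      ∂((volume : Measure ℝ).prod (volume : Measure Y)) =
        ∫⁻ z, ∫⁻ w, S.indicator (1 : (ℝ × Y) × (ℝ × Y) → ℝ≥0∞) ((t, y), (w, z)) := fun t =>
    lintegral_prod_symm' _ (hf.comp measurable_prodMk_left)
  simp only [h1]
  have hf4 : Measurable fun a : (ℝ × Y) × ℝ =>
      S.indicator (1 : (ℝ × Y) × (ℝ × Y) → ℝ≥0∞) ((a.1.1, y), (a.2, a.1.2)) := hf.comp (by fun_prop)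
  rw [lintegral_lintegral_swap hf4.lintegral_prod_right'.aemeasurable]
  refine lintegral_congr fun z => ?_
  have hT : MeasurableSet {p : ℝ × ℝ |
      p.1 ∈ Φ.line B y ∧ p.2 ∈ Φ.line C z ∧ p.1 + p.2 ∈ Φ.line A (y + z)} :=
    (measurable_fst (Φ.measurableSet_line hB y)).inter
      ((measurable_snd (Φ.measurableSet_line hC z)).inter
        (measurable_add (Φ.measurableSet_line hA _)))
  rw [addTriple, ← lintegral_indicator_one hT, Measure.volume_eq_prod,
    lintegral_prod _ (measurable_one.indicator hT).aemeasurable]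
  refine lintegral_congr fun t => lintegral_congr fun w => ?_
  have : ((t, y), (w, z)) ∈ S ↔ (t, w) ∈ {p : ℝ × ℝ |
      p.1 ∈ Φ.line B y ∧ p.2 ∈ Φ.line C z ∧ p.1 + p.2 ∈ Φ.line A (y + z)} := by
    change (Φ.toEquiv (t, y) ∈ B ∧ Φ.toEquiv (w, z) ∈ C ∧
      Φ.toEquiv (t, y) + Φ.toEquiv (w, z) ∈ A) ↔ _
    rw [← Φ.map_add]
    rfl
  by_cases h : ((t, y), (w, z)) ∈ S
  · rw [indicator_of_mem h, indicator_of_mem (this.1 h)]; rfl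
  · rw [indicator_of_notMem h, indicator_of_notMem (fun h' => h (this.2 h'))]

lemma addTriple_le_steiner [MeasurableAdd₂ E] (hA : MeasurableSet A) (hB : MeasurableSet B)
    (hC : MeasurableSet C) {R : ℝ} (hAR : A ⊆ Metric.ball 0 R) (hBR : B ⊆ Metric.ball 0 R)
    (hCR : C ⊆ Metric.ball 0 R) :
    addTriple A B C ≤ addTriple (Φ.steiner A) (Φ.steiner B) (Φ.steiner C) := by
  rw [Φ.addTriple_eq_lintegral_line hA hB hC, Φ.addTriple_eq_lintegral_line
    (Φ.measurableSet_steiner hA) (Φ.measurableSet_steiner hB) (Φ.measurableSet_steiner hC)]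
  refine lintegral_mono fun y => lintegral_mono fun z => ?_
  simp only [line_steiner]
  exact addTriple_le_intervalRearrange (Φ.measurableSet_line hA _) (Φ.measurableSet_line hB _)
    (Φ.measurableSet_line hC _) (Φ.volume_line_ne_top hAR _) (Φ.volume_line_ne_top hBR _)
    (Φ.volume_line_ne_top hCR _)

/-- Steiner symmetrization brings `A` closer to a centered ball `D`, by at least the measure of
the part of `A \ D` which is translated into `D \ A` by a vector in the direction of
symmetrization. -/
lemma volume_steiner_sdiff_add_le [MeasurableAdd₂ E] (hA : MeasurableSet A) {R r : ℝ}
    (hAR : A ⊆ Metric.ball 0 R) (hD : MeasurableSet (Metric.ball (0 : E) r)) (s : ℝ) :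
    volume (Φ.steiner A \ Metric.ball 0 r) +
      volume {x | x ∈ A \ Metric.ball 0 r ∧ x + Φ.toEquiv (s, 0) ∈ Metric.ball 0 r \ A} ≤
        volume (A \ Metric.ball 0 r) := by
  set D := Metric.ball (0 : E) r
  have hM : MeasurableSet {x | x ∈ A \ D ∧ x + Φ.toEquiv (s, 0) ∈ D \ A} :=
    (hA.diff hD).inter ((measurable_id.add_const _) (hD.diff hA))
  rw [Φ.volume_eq_lintegral_line ((Φ.measurableSet_steiner hA).diff hD),
    Φ.volume_eq_lintegral_line hM, Φ.volume_eq_lintegral_line (hA.diff hD),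
    ← lintegral_add_right _ (Φ.measurable_volume_line hM)]
  refine lintegral_mono fun y => ?_
  have hPfin := Φ.volume_line_ne_top hAR y
  have hQfin : volume (Φ.line D y) ≠ ⊤ := Φ.volume_line_ne_top Subset.rfl y
  have hP := Φ.measurableSet_line hA y
  have hQ := Φ.measurableSet_line hD y
  have e1 : Φ.line (Φ.steiner A \ D) y =
      intervalRearrange (Φ.line A y) \ intervalRearrange (Φ.line D y) := by
    rw [Φ.intervalRearrange_line_ball, ← line_steiner]; rfl
  have e2 : Φ.line (A \ D) y = Φ.line A y \ Φ.line D y := rfl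
  have e3 : Φ.line {x | x ∈ A \ D ∧ x + Φ.toEquiv (s, 0) ∈ D \ A} y =
      {t | t ∈ Φ.line A y \ Φ.line D y ∧ t + s ∈ Φ.line D y \ Φ.line A y} := by
    ext t
    simp [line, ← Φ.map_add]
  rw [e1, e2, e3]
  set P := Φ.line A y
  set Q := Φ.line D y
  set W := {t | t ∈ P \ Q ∧ t + s ∈ Q \ P}
  have hW1 : volume W ≤ volume (P \ Q) := measure_mono fun t ht => ht.1
  have hW2 : volume W ≤ volume (Q \ P) := by
    rw [← measure_preimage_add_right volume s (Q \ P)]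
    exact measure_mono fun t ht => ht.2
  rcases le_total (volume P) (volume Q) with h | h
  · have : intervalRearrange P \ intervalRearrange Q = ∅ :=
      sdiff_eq_empty.2 fun t ht => lt_of_lt_of_le ht h
    rw [this, measure_empty, zero_add]
    exact hW1
  · have hsub : intervalRearrange Q ⊆ intervalRearrange P := fun t ht => lt_of_lt_of_le ht h
    have hIQ : MeasurableSet (intervalRearrange Q) := by
      rw [intervalRearrange_eq hQfin]; exact measurableSet_two_mul_abs_lt _
    rw [measure_sdiff hsub hIQ.nullMeasurableSet (by rwa [volume_intervalRearrange hQfin]),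
      volume_intervalRearrange hPfin, volume_intervalRearrange hQfin]
    refine (add_le_add_right hW2 _).trans ?_
    have h1 := measure_inter_add_sdiff (μ := volume) P hQ
    have h2 := measure_inter_add_sdiff (μ := volume) Q hP
    have hfin : volume (P ∩ Q) ≠ ⊤ := ne_top_of_le_ne_top hPfin (measure_mono inter_subset_left)
    rw [inter_comm Q P] at h2
    rw [← ENNReal.add_le_add_iff_left hfin, add_left_comm, h2, h1, tsub_add_cancel_of_le h]

end LineCoords

section BallRearrange

variable {n : ℕ} {A B C : Set (EuclideanSpace ℝ (Fin n))}

lemma ballRearrange_subset (h : volume A ≤ volume B) : ballRearrange n A ⊆ ballRearrange n B :=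
  fun _ hx => lt_of_lt_of_le (show volume _ < _ from hx) h

lemma measurable_volume_ball_norm :
    Measurable fun x : EuclideanSpace ℝ (Fin n) =>
      volume (Metric.ball (0 : EuclideanSpace ℝ (Fin n)) ‖x‖) :=
  (Monotone.measurable (f := fun r : ℝ => volume (Metric.ball (0 : EuclideanSpace ℝ (Fin n)) r))
    fun _ _ h => measure_mono (Metric.ball_subset_ball h)).comp measurable_norm

lemma measurableSet_ballRearrange : MeasurableSet (ballRearrange n A) :=
  measurableSet_lt measurable_volume_ball_norm measurable_const

lemma exists_ballRearrange_eq_ball (hA : volume A ≠ ⊤) :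
    ∃ r, ballRearrange n A = Metric.ball 0 r ∧
      volume (Metric.ball (0 : EuclideanSpace ℝ (Fin n)) r) = volume A := by
  rcases n with _ | n
  · rcases A.eq_empty_or_nonempty with rfl | hne
    · exact ⟨0, by simp [ballRearrange], by simp⟩
    · have hu : A = univ := Subsingleton.eq_univ_of_nonempty hne
      have hb : Metric.ball (0 : EuclideanSpace ℝ (Fin 0)) 1 = univ :=
        Subsingleton.eq_univ_of_nonempty (Metric.nonempty_ball.2 one_pos)
      refine ⟨1, ?_, by rw [hb, hu]⟩
      rw [hb, eq_univ_iff_forall, hu]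
      intro x
      have : volume (Metric.ball (0 : EuclideanSpace ℝ (Fin 0)) ‖x‖) <
          volume (univ : Set (EuclideanSpace ℝ (Fin 0))) := by
        rw [Subsingleton.elim x 0, norm_zero, Metric.ball_zero, measure_empty]
        exact isOpen_univ.measure_pos _ univ_nonempty
      exact this
  · set V := volume (Metric.ball (0 : EuclideanSpace ℝ (Fin (n + 1))) 1)
    have hV0 : V ≠ 0 := (Metric.measure_ball_pos _ _ one_pos).ne'
    have hVt : V ≠ ⊤ := measure_ball_lt_top.ne
    have hball : ∀ r : ℝ, 0 ≤ r → volume (Metric.ball (0 : EuclideanSpace ℝ (Fin (n + 1))) r) =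
        ENNReal.ofReal (r ^ (n + 1)) * V := fun r hr => by
      rw [Measure.addHaar_ball _ _ hr, finrank_euclideanSpace_fin]
    set c := (volume A / V).toReal
    have hc : 0 ≤ c := toReal_nonneg
    set r := c ^ (((n + 1 : ℕ) : ℝ)⁻¹)
    have hr : 0 ≤ r := by positivity
    have hrn : r ^ (n + 1) = c := Real.rpow_inv_natCast_pow hc (by simp)
    have hvol : volume (Metric.ball (0 : EuclideanSpace ℝ (Fin (n + 1))) r) = volume A := by
      rw [hball r hr, hrn, ofReal_toReal (ENNReal.div_ne_top hA hV0),
        ENNReal.div_mul_cancel hV0 hVt]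
    refine ⟨r, ?_, hvol⟩
    ext x
    rw [mem_ball_zero_iff]
    change volume _ < volume A ↔ _
    rw [← hvol, hball _ (norm_nonneg x), hball r hr, ENNReal.mul_lt_mul_iff_left hV0 hVt,
      ofReal_lt_ofReal_iff_of_nonneg (by positivity), pow_lt_pow_iff_left₀ (norm_nonneg x) hr
      (by simp)]

lemma volume_ballRearrange_le : volume (ballRearrange n A) ≤ volume A := by
  by_cases h : volume A = ⊤
  · rw [h]; exact le_top
  · obtain ⟨r, h1, h2⟩ := exists_ballRearrange_eq_ball h
    rw [h1, h2]

lemma lintegral_volume_inter_translate {P Q : Set (EuclideanSpace ℝ (Fin n))}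
    (hP : MeasurableSet P) (hQ : MeasurableSet Q) :
    ∫⁻ u, volume {x | x ∈ P ∧ x + u ∈ Q} = volume P * volume Q := by
  have hmp := measurePreserving_prod_add_swap (volume : Measure (EuclideanSpace ℝ (Fin n)))
    (volume : Measure (EuclideanSpace ℝ (Fin n)))
  rw [← Measure.prod_prod, ← hmp.measure_preimage (hP.prod hQ).nullMeasurableSet,
    Measure.prod_apply (hmp.measurable (hP.prod hQ))]
  rfl

lemma exists_le_volume_inter_translate {P Q : Set (EuclideanSpace ℝ (Fin n))} {R : ℝ}
    (hP : MeasurableSet P) (hQ : MeasurableSet Q)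
    (hPR : P ⊆ Metric.ball 0 R) (hQR : Q ⊆ Metric.ball 0 R) (hP0 : volume P ≠ 0)
    (hPQ : volume P = volume Q) :
    ∃ u, volume P ^ 2 / (2 * volume (Metric.ball (0 : EuclideanSpace ℝ (Fin n)) (2 * R))) ≤
      volume {x | x ∈ P ∧ x + u ∈ Q} := by
  set V := volume (Metric.ball (0 : EuclideanSpace ℝ (Fin n)) (2 * R))
  have hPt : volume P ≠ ⊤ := ne_top_of_le_ne_top measure_ball_lt_top.ne (measure_mono hPR)
  have hR : 0 < R := by
    by_contra h
    rw [Metric.ball_eq_empty.2 (not_lt.1 h), subset_empty_iff] at hPR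
    simp [hPR] at hP0
  have hV0 : V ≠ 0 := (Metric.measure_ball_pos _ _ (by positivity)).ne'
  have hVt : V ≠ ⊤ := measure_ball_lt_top.ne
  by_contra! hlt
  have hint := lintegral_volume_inter_translate hP hQ
  rw [← hPQ, ← sq] at hint
  have hle : ∫⁻ u, volume {x | x ∈ P ∧ x + u ∈ Q} ≤
      ∫⁻ u in Metric.ball (0 : EuclideanSpace ℝ (Fin n)) (2 * R), volume P ^ 2 / (2 * V) := by
    rw [← lintegral_indicator measurableSet_ball]
    refine lintegral_mono fun u => ?_
    by_cases hu : u ∈ Metric.ball (0 : EuclideanSpace ℝ (Fin n)) (2 * R)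
    · rw [indicator_of_mem hu]; exact (hlt u).le
    · rw [indicator_of_notMem hu, nonpos_iff_eq_zero,
        ← measure_empty (μ := (volume : Measure (EuclideanSpace ℝ (Fin n))))]
      congr 1
      refine eq_empty_iff_forall_notMem.2 fun x hx => hu ?_
      have h1 := mem_ball_zero_iff.1 (hPR hx.1)
      have h2 := mem_ball_zero_iff.1 (hQR hx.2)
      rw [mem_ball_zero_iff]
      calc ‖u‖ = ‖(x + u) - x‖ := by simp
        _ ≤ ‖x + u‖ + ‖x‖ := norm_sub_le _ _
        _ < 2 * R := by linarith
  rw [hint, setLIntegral_const] at hle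
  have hne : volume P ^ 2 ≠ 0 := pow_ne_zero _ hP0
  have hne' : volume P ^ 2 ≠ ⊤ := ENNReal.pow_ne_top hPt
  have : volume P ^ 2 / (2 * V) * V = volume P ^ 2 / 2 := by
    rw [ENNReal.div_eq_inv_mul, ENNReal.mul_inv (by simp) (by simp), mul_assoc, mul_assoc,
      mul_comm _ V, ← mul_assoc V⁻¹, ENNReal.inv_mul_cancel hV0 hVt, one_mul,
      ENNReal.div_eq_inv_mul]
  rw [this] at hle
  exact absurd (ENNReal.half_lt_self hne hne') (not_lt.2 hle)

lemma volume_sdiff_eq_of_volume_eq (hA : MeasurableSet A) (hB : MeasurableSet B)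
    (h : volume A = volume B) (hfin : volume A ≠ ⊤) : volume (A \ B) = volume (B \ A) := by
  have h1 := measure_inter_add_sdiff (μ := volume) A hB
  have h2 := measure_inter_add_sdiff (μ := volume) B hA
  have hfin : volume (A ∩ B) ≠ ⊤ := ne_top_of_le_ne_top hfin (measure_mono inter_subset_left)
  rw [inter_comm B A, ← h, ← h1] at h2
  exact ((ENNReal.add_right_inj hfin).1 h2).symm

/-- A triple of sets in `ball 0 R`, with the volumes of the balls of radii `r i`, for which
`addTriple` is at least `J`. -/
structure IsCandidate (R : ℝ) (r : Fin 3 → ℝ) (J : ℝ≥0∞)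
    (F : Fin 3 → Set (EuclideanSpace ℝ (Fin n))) : Prop where
  measurableSet : ∀ i, MeasurableSet (F i)
  subset : ∀ i, F i ⊆ Metric.ball 0 R
  volume_eq : ∀ i, volume (F i) = volume (Metric.ball (0 : EuclideanSpace ℝ (Fin n)) (r i))
  le_addTriple : J ≤ addTriple (F 0) (F 1) (F 2)

lemma IsCandidate.exists_closer {R : ℝ} {r : Fin 3 → ℝ} {J : ℝ≥0∞}
    {F : Fin 3 → Set (EuclideanSpace ℝ (Fin n))} (hF : IsCandidate R r J F)
    (hr : ∀ i, Metric.ball (0 : EuclideanSpace ℝ (Fin n)) (r i) ⊆ Metric.ball 0 R)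
    {m : ℝ≥0∞} (hm0 : m ≠ 0) (hm : m ≤ ∑ i, volume (F i \ Metric.ball 0 (r i))) :
    ∃ F' : Fin 3 → Set (EuclideanSpace ℝ (Fin n)), IsCandidate R r J F' ∧
      ∑ i, volume (F' i \ Metric.ball 0 (r i)) +
      (m / 3) ^ 2 / (2 * volume (Metric.ball (0 : EuclideanSpace ℝ (Fin n)) (2 * R))) ≤
        ∑ i, volume (F i \ Metric.ball 0 (r i)) := by
  obtain ⟨i, -, hi⟩ := Finset.exists_max_image Finset.univ
    (fun i => volume (F i \ Metric.ball 0 (r i))) Finset.univ_nonempty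
  have hi3 : m / 3 ≤ volume (F i \ Metric.ball 0 (r i)) := by
    refine ENNReal.div_le_of_le_mul (hm.trans ?_)
    refine (Finset.sum_le_card_nsmul _ _ _ hi).trans (le_of_eq ?_)
    simp [mul_comm]
  have hpos : volume (F i \ Metric.ball 0 (r i)) ≠ 0 := by
    intro h
    rw [h, nonpos_iff_eq_zero, ENNReal.div_eq_zero_iff] at hi3
    rcases hi3 with h | h
    · exact hm0 h
    · exact absurd h (by simp)
  have hfin : ∀ j, volume (F j) ≠ ⊤ := fun j =>
    ne_top_of_le_ne_top measure_ball_lt_top.ne (measure_mono (hF.subset j))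
  obtain ⟨u, hu⟩ := exists_le_volume_inter_translate
    ((hF.measurableSet i).diff measurableSet_ball) (measurableSet_ball.diff (hF.measurableSet i))
    (sdiff_subset.trans (hF.subset i)) (sdiff_subset.trans (hr i)) hpos
    (volume_sdiff_eq_of_volume_eq (hF.measurableSet i) measurableSet_ball (hF.volume_eq i) (hfin i))
  have hne : n ≠ 0 := by
    rintro rfl
    have hu0 : {x | x ∈ F i \ Metric.ball 0 (r i) ∧ x + u ∈ Metric.ball 0 (r i) \ F i} = ∅ := by
      refine eq_empty_iff_forall_notMem.2 fun x hx => hx.2.2 ?_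
      rw [Subsingleton.elim (x + u) x]
      exact hx.1.1
    rw [hu0, measure_empty, nonpos_iff_eq_zero, ENNReal.div_eq_zero_iff] at hu
    rcases hu with h | h
    · exact hpos (by simpa using h)
    · exact ENNReal.mul_ne_top (by simp) measure_ball_lt_top.ne h
  obtain ⟨k, rfl⟩ := Nat.exists_eq_succ_of_ne_zero hne
  obtain ⟨Φ, s, hΦ⟩ := exists_lineCoords (u := u)
  have hsteiner := fun j =>
    Φ.volume_steiner_sdiff_add_le (hF.measurableSet j) (hF.subset j) (r := r j) measurableSet_ball s
  refine ⟨fun j => Φ.steiner (F j), ⟨fun j => Φ.measurableSet_steiner (hF.measurableSet j),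
    fun j => Φ.steiner_subset_ball (hF.subset j), fun j => ?_, ?_⟩, ?_⟩
  · rw [Φ.volume_steiner (hF.measurableSet j) (Φ.volume_line_ne_top (hF.subset j)), hF.volume_eq]
  · exact hF.le_addTriple.trans (Φ.addTriple_le_steiner (hF.measurableSet 0) (hF.measurableSet 1)
      (hF.measurableSet 2) (hF.subset 0) (hF.subset 1) (hF.subset 2))
  · rw [← Finset.add_sum_erase _ _ (Finset.mem_univ i), ← Finset.add_sum_erase _ (fun i =>
      volume (F i \ Metric.ball 0 (r i))) (Finset.mem_univ i), add_right_comm]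
    refine add_le_add (le_trans ?_ (hsteiner i)) (Finset.sum_le_sum fun j _ =>
      le_self_add.trans (hsteiner j))
    gcongr
    rw [hΦ]
    refine le_trans ?_ hu
    gcongr

lemma IsCandidate.exists_close {R : ℝ} {r : Fin 3 → ℝ} {J : ℝ≥0∞}
    {F : Fin 3 → Set (EuclideanSpace ℝ (Fin n))} (hF : IsCandidate R r J F)
    (hr : ∀ i, Metric.ball (0 : EuclideanSpace ℝ (Fin n)) (r i) ⊆ Metric.ball 0 R)
    {ε : ℝ≥0∞} (hε : ε ≠ 0) :
    ∃ F' : Fin 3 → Set (EuclideanSpace ℝ (Fin n)), IsCandidate R r J F' ∧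
      ∑ i, volume (F' i \ Metric.ball 0 (r i)) < ε := by
  set m := ⨅ G : {G : Fin 3 → Set (EuclideanSpace ℝ (Fin n)) // IsCandidate R r J G},
    ∑ i, volume (G.1 i \ Metric.ball 0 (r i)) with hm
  have hmF : m ≤ ∑ i, volume (F i \ Metric.ball 0 (r i)) :=
    iInf_le_of_le ⟨F, hF⟩ le_rfl
  have hmt : m ≠ ⊤ := by
    refine ne_top_of_le_ne_top (ENNReal.sum_ne_top.2 fun i _ => ?_) hmF
    exact ne_top_of_le_ne_top measure_ball_lt_top.ne
      (measure_mono (sdiff_subset.trans (hF.subset i)))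
  have hm0 : m = 0 := by
    by_contra hm0
    set η := (m / 3) ^ 2 / (2 * volume (Metric.ball (0 : EuclideanSpace ℝ (Fin n)) (2 * R)))
    have hη : η ≠ 0 := by
      refine (ENNReal.div_pos (pow_ne_zero _ (ENNReal.div_pos hm0 (by simp)).ne') ?_).ne'
      exact ENNReal.mul_ne_top (by simp) measure_ball_lt_top.ne
    have : m + η ≤ m := by
      conv_rhs => rw [hm]
      refine le_iInf fun G => ?_
      obtain ⟨G', hG', hle⟩ := G.2.exists_closer hr hm0 (iInf_le _ G)
      have hmG' : m ≤ ∑ i, volume (G' i \ Metric.ball 0 (r i)) := iInf_le_of_le ⟨G', hG'⟩ le_rfl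
      exact le_trans (by gcongr) hle
    exact absurd this (not_le.2 (ENNReal.lt_add_right hmt hη))
  have : m < ε := by rw [hm0]; exact pos_iff_ne_zero.2 hε
  obtain ⟨G, hG⟩ := iInf_lt_iff.1 this
  exact ⟨G.1, G.2, hG⟩

lemma addTriple_le_ballRearrange_of_subset_ball (hA : MeasurableSet A) (hB : MeasurableSet B)
    (hC : MeasurableSet C) {R : ℝ} (hAR : A ⊆ Metric.ball 0 R) (hBR : B ⊆ Metric.ball 0 R)
    (hCR : C ⊆ Metric.ball 0 R) :
    addTriple A B C ≤ addTriple (ballRearrange n A) (ballRearrange n B) (ballRearrange n C) := by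
  set F : Fin 3 → Set (EuclideanSpace ℝ (Fin n)) := ![A, B, C]
  have hFm : ∀ i, MeasurableSet (F i) := by simp [F, Fin.forall_fin_succ, *]
  have hFR : ∀ i, F i ⊆ Metric.ball 0 R := by simp [F, Fin.forall_fin_succ, *]
  have hfin : ∀ i, volume (F i) ≠ ⊤ := fun i =>
    ne_top_of_le_ne_top measure_ball_lt_top.ne (measure_mono (hFR i))
  choose r hr hrv using fun i => exists_ballRearrange_eq_ball (hfin i)
  have hrR : ∀ i, Metric.ball (0 : EuclideanSpace ℝ (Fin n)) (r i) ⊆ Metric.ball 0 R := by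
    intro i x hx
    rw [← hr i] at hx
    by_contra hxR
    have hx' : volume (Metric.ball (0 : EuclideanSpace ℝ (Fin n)) ‖x‖) < volume (F i) := hx
    rw [mem_ball_zero_iff, not_lt] at hxR
    exact absurd (measure_mono (μ := volume) ((hFR i).trans (Metric.ball_subset_ball hxR)))
      (not_le.2 hx')
  have hcand : IsCandidate R r (addTriple A B C) F := ⟨hFm, hFR, fun i => (hrv i).symm, le_rfl⟩
  set M := volume (Metric.ball (0 : EuclideanSpace ℝ (Fin n)) R)
  have hM : M ≠ ⊤ := measure_ball_lt_top.ne
  refine ENNReal.le_of_forall_pos_le_add fun ε hε _ => ?_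
  obtain ⟨G, hG, hGε⟩ := hcand.exists_close hrR (ε := ε / M)
    (ENNReal.div_pos (by exact_mod_cast hε.ne') hM).ne'
  refine hG.le_addTriple.trans ?_
  refine (addTriple_le_add_diff (hG.measurableSet 0) (hG.measurableSet 1) (hG.measurableSet 2)
    (A' := Metric.ball 0 (r 0)) (B' := Metric.ball 0 (r 1)) (C' := Metric.ball 0 (r 2))
    measurableSet_ball).trans ?_
  rw [add_assoc, add_assoc]
  refine add_le_add (le_of_eq ?_) ?_
  · rw [← hr 0, ← hr 1, ← hr 2]; rfl
  · have hGM : ∀ i, volume (G i) ≤ M := fun i => measure_mono (hG.subset i)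
    refine le_trans ?_ (ENNReal.mul_le_of_le_div hGε.le)
    rw [Fin.sum_univ_three, add_mul, add_mul, ← add_assoc]
    gcongr <;> apply hGM

/-- The Riesz rearrangement inequality for sets. -/
lemma addTriple_le_ballRearrange (hA : MeasurableSet A) (hB : MeasurableSet B)
    (hC : MeasurableSet C) :
    addTriple A B C ≤ addTriple (ballRearrange n A) (ballRearrange n B) (ballRearrange n C) := by
  set b : ℕ → Set (EuclideanSpace ℝ (Fin n)) := fun k => Metric.ball 0 k
  have hb : Monotone b := fun i j h => Metric.ball_subset_ball (by exact_mod_cast h)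
  have hbm : ∀ k, MeasurableSet (b k) := fun k => measurableSet_ball
  have hU : {p : EuclideanSpace ℝ (Fin n) × EuclideanSpace ℝ (Fin n) |
      p.1 ∈ B ∧ p.2 ∈ C ∧ p.1 + p.2 ∈ A} ⊆ ⋃ k, {p | p.1 ∈ B ∩ b k ∧ p.2 ∈ C ∩ b k ∧
        p.1 + p.2 ∈ A ∩ b k} := by
    rintro p ⟨h1, h2, h3⟩
    obtain ⟨k, hk⟩ := exists_nat_gt (max (max ‖p.1‖ ‖p.2‖) ‖p.1 + p.2‖)
    simp only [max_lt_iff] at hk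
    exact mem_iUnion.2 ⟨k, ⟨h1, mem_ball_zero_iff.2 hk.1.1⟩, ⟨h2, mem_ball_zero_iff.2 hk.1.2⟩,
      ⟨h3, mem_ball_zero_iff.2 hk.2⟩⟩
  refine (measure_mono hU).trans ?_
  rw [Monotone.measure_iUnion]
  · refine iSup_le fun k => ?_
    refine (addTriple_le_ballRearrange_of_subset_ball (hA.inter (hbm k)) (hB.inter (hbm k))
      (hC.inter (hbm k)) inter_subset_right inter_subset_right inter_subset_right).trans ?_
    exact addTriple_mono (ballRearrange_subset (measure_mono inter_subset_left))
      (ballRearrange_subset (measure_mono inter_subset_left))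
      (ballRearrange_subset (measure_mono inter_subset_left))
  · exact fun i j h p hp => ⟨⟨hp.1.1, hb h hp.1.2⟩, ⟨hp.2.1.1, hb h hp.2.1.2⟩,
      ⟨hp.2.2.1, hb h hp.2.2.2⟩⟩

end BallRearrange

section Layers

/-- `f` is the integral over `t > 0` of the indicators of the sets `S t`. -/
structure IsLayered {α : Type*} [MeasurableSpace α] (f : α → ℝ≥0∞) (S : ℝ → Set α) : Prop where
  measurableSet : MeasurableSet {p : α × ℝ | p.1 ∈ S p.2}
  eq_lintegral : ∀ x, f x = ∫⁻ t in Ioi (0 : ℝ), (S t).indicator 1 x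

variable {α : Type*} [MeasurableSpace α] {f : α → ℝ≥0∞} {S : ℝ → Set α}

lemma IsLayered.measurableSet_layer (h : IsLayered f S) (t : ℝ) : MeasurableSet (S t) :=
  measurable_prodMk_right h.measurableSet

lemma IsLayered.measurable_uncurry (h : IsLayered f S) :
    Measurable fun p : α × ℝ => (S p.2).indicator (1 : α → ℝ≥0∞) p.1 :=
  (measurable_const (a := (1 : ℝ≥0∞))).indicator h.measurableSet

lemma IsLayered.measurable (h : IsLayered f S) : Measurable f := by
  rw [funext h.eq_lintegral]
  exact h.measurable_uncurry.lintegral_prod_right'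

lemma IsLayered.lintegral_mul {μ : Measure α} [SFinite μ] (h : IsLayered f S) {g : α → ℝ≥0∞}
    (hg : Measurable g) :
    ∫⁻ x, g x * f x ∂μ = ∫⁻ t in Ioi (0 : ℝ), ∫⁻ x in S t, g x ∂μ := by
  have h1 : ∀ x, g x * f x = ∫⁻ t in Ioi (0 : ℝ), g x * (S t).indicator 1 x := fun x => by
    rw [h.eq_lintegral, lintegral_const_mul]
    exact h.measurable_uncurry.comp measurable_prodMk_left
  simp_rw [h1]
  rw [lintegral_lintegral_swap ((hg.comp measurable_fst).mul h.measurable_uncurry).aemeasurable]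
  refine lintegral_congr fun t => ?_
  rw [← lintegral_indicator (h.measurableSet_layer t)]
  refine lintegral_congr fun x => ?_
  by_cases hx : x ∈ S t <;> simp [hx]

lemma IsLayered.setLIntegral {μ : Measure α} [SFinite μ] (h : IsLayered f S)
    (A : Set α) :
    ∫⁻ x in A, f x ∂μ = ∫⁻ t in Ioi (0 : ℝ), μ (S t ∩ A) := by
  have := h.lintegral_mul (μ := μ.restrict A) (g := 1) measurable_one
  simp only [Pi.one_apply, one_mul, setLIntegral_one] at this
  rw [this]
  exact lintegral_congr fun t => Measure.restrict_apply (h.measurableSet_layer t)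

lemma volume_setOf_ofReal_lt (a : ℝ≥0∞) {τ : ℝ} (hτ : 0 ≤ τ) :
    volume ({t : ℝ | ENNReal.ofReal t < a} ∩ Ioi τ) = a - ENNReal.ofReal τ := by
  rcases eq_or_ne a ⊤ with rfl | ha
  · simp [ENNReal.ofReal_lt_top]
  · have : {t : ℝ | ENNReal.ofReal t < a} ∩ Ioi τ = Ioo τ a.toReal := by
      ext t
      refine ⟨fun h => ⟨h.2, ?_⟩, fun h => ⟨?_, h.1⟩⟩
      · exact (ENNReal.ofReal_lt_iff_lt_toReal (hτ.trans (le_of_lt h.2)) ha).1 h.1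
      · exact (ENNReal.ofReal_lt_iff_lt_toReal (hτ.trans h.1.le) ha).2 h.2
    rw [this, Real.volume_Ioo, ENNReal.ofReal_sub _ hτ, ENNReal.ofReal_toReal ha]

lemma measurableSet_setOf_ofReal_lt (hf : Measurable f) :
    MeasurableSet {p : α × ℝ | ENNReal.ofReal p.2 < f p.1} :=
  measurableSet_lt (ENNReal.measurable_ofReal.comp measurable_snd) (hf.comp measurable_fst)

lemma lintegral_indicator_superlevel {β : Type*} (f : β → ℝ≥0∞) (x : β) {τ : ℝ} (hτ : 0 ≤ τ) :
    ∫⁻ t in Ioi τ, {x | ENNReal.ofReal t < f x}.indicator 1 x = f x - ENNReal.ofReal τ := by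
  have hm : MeasurableSet {t : ℝ | ENNReal.ofReal t < f x} :=
    measurableSet_lt ENNReal.measurable_ofReal measurable_const
  rw [← volume_setOf_ofReal_lt _ hτ, ← Measure.restrict_apply hm, ← lintegral_indicator_one hm]
  rfl

lemma lintegral_tsub_eq {μ : Measure α} [SFinite μ] (hf : Measurable f) {τ : ℝ} (hτ : 0 ≤ τ) :
    ∫⁻ x, (f x - ENNReal.ofReal τ) ∂μ = ∫⁻ t in Ioi τ, μ {x | ENNReal.ofReal t < f x} := by
  have hm := measurableSet_setOf_ofReal_lt hf
  simp_rw [← lintegral_indicator_superlevel f _ hτ]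
  rw [lintegral_lintegral_swap]
  · exact lintegral_congr fun t => lintegral_indicator_one (measurable_prodMk_right hm)
  · exact (measurable_one.indicator hm).aemeasurable

lemma isLayered_superlevel (hf : Measurable f) :
    IsLayered f fun t => {x | ENNReal.ofReal t < f x} where
  measurableSet := measurableSet_setOf_ofReal_lt hf
  eq_lintegral x := by
    rw [lintegral_indicator_superlevel f x le_rfl, ENNReal.ofReal_zero, tsub_zero]

end Layers

section Rearrangement

variable {n : ℕ} {f g F G : EuclideanSpace ℝ (Fin n) → ℝ≥0∞}
  {A B : Set (EuclideanSpace ℝ (Fin n))}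

lemma isLayered_symmRearr : IsLayered (symmRearr n f)
    fun t => ballRearrange n {x | ENNReal.ofReal t < f x} where
  measurableSet := by
    refine measurableSet_lt (measurable_volume_ball_norm.comp measurable_fst) ?_
    refine (Antitone.measurable (f := fun t : ℝ => volume {x | ENNReal.ofReal t < f x}) ?_).comp
      measurable_snd
    exact fun s t hst => measure_mono fun x hx => (ENNReal.ofReal_le_ofReal hst).trans_lt hx
  eq_lintegral _ := rfl

/-- `G x` decreases with `‖x‖`. -/
def IsRadiallyDecreasing (G : EuclideanSpace ℝ (Fin n) → ℝ≥0∞) : Prop :=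
  ∀ ⦃x y⦄, ‖x‖ ≤ ‖y‖ → G y ≤ G x

lemma IsRadiallyDecreasing.neg_apply (hG : IsRadiallyDecreasing G) (x) : G (-x) = G x :=
  le_antisymm (hG (norm_neg x).ge) (hG (norm_neg x).le)

lemma isRadiallyDecreasing_indicator_ballRearrange :
    IsRadiallyDecreasing ((ballRearrange n A).indicator 1) := fun x y hxy => by
  by_cases hy : y ∈ ballRearrange n A
  · have hx : x ∈ ballRearrange n A :=
      (measure_mono (Metric.ball_subset_ball hxy)).trans_lt (show volume _ < _ from hy)
    simp [hx, hy]
  · simp [hy]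

lemma isRadiallyDecreasing_symmRearr : IsRadiallyDecreasing (symmRearr n f) := fun _ _ hxy =>
  lintegral_mono fun _ => isRadiallyDecreasing_indicator_ballRearrange hxy

lemma measurable_conv2 (hf : Measurable f) (hg : Measurable g) : Measurable (conv2 n f g) :=
  Measurable.lintegral_prod_right' (f := fun p : EuclideanSpace ℝ (Fin n) × _ =>
    f p.2 * g (p.1 - p.2)) (by fun_prop)

lemma conv2_comm : conv2 n f g = conv2 n g f := by
  ext x
  refine (lintegral_sub_left_eq_self (fun y => f y * g (x - y)) x).symm.trans ?_
  refine lintegral_congr fun y => ?_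
  rw [_root_.sub_sub_cancel, mul_comm]

lemma setLIntegral_conv2 (hf : Measurable f) (hg : Measurable g) :
    ∫⁻ x in A, conv2 n f g x = ∫⁻ z, f z * ∫⁻ x in A, g (x - z) := by
  have hm : Measurable fun p : EuclideanSpace ℝ (Fin n) × EuclideanSpace ℝ (Fin n) =>
    f p.2 * g (p.1 - p.2) := by fun_prop
  refine (lintegral_lintegral_swap hm.aemeasurable).trans (lintegral_congr fun z => ?_)
  exact lintegral_const_mul _ (by fun_prop)

lemma lintegral_conv2 (hf : Measurable f) (hg : Measurable g) :
    ∫⁻ x, conv2 n f g x = (∫⁻ x, f x) * ∫⁻ x, g x := by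
  have h := setLIntegral_conv2 (A := univ) hf hg
  simp_rw [Measure.restrict_univ, lintegral_sub_right_eq_self g] at h
  rw [h, lintegral_mul_const _ hf]

lemma IsLayered.setLIntegral_conv2 {S : ℝ → Set (EuclideanSpace ℝ (Fin n))} (hf : IsLayered f S)
    (hg : Measurable g) :
    ∫⁻ x in A, conv2 n f g x = ∫⁻ t in Ioi (0 : ℝ), ∫⁻ x in A, conv2 n ((S t).indicator 1) g x := by
  have hm : Measurable fun z => ∫⁻ x in A, g (x - z) :=
    Measurable.lintegral_prod_right' (f := fun p : EuclideanSpace ℝ (Fin n) × _ =>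
      g (p.2 - p.1)) (by fun_prop)
  rw [_root_.setLIntegral_conv2 hf.measurable hg]
  simp_rw [mul_comm (f _)]
  rw [hf.lintegral_mul hm]
  refine lintegral_congr fun t => ?_
  rw [_root_.setLIntegral_conv2 (measurable_one.indicator (hf.measurableSet_layer t)) hg,
    ← lintegral_indicator (hf.measurableSet_layer t)]
  refine lintegral_congr fun x => ?_
  by_cases hx : x ∈ S t <;> simp [hx]

lemma setLIntegral_conv2_indicator {B C : Set (EuclideanSpace ℝ (Fin n))} (hA : MeasurableSet A)
    (hB : MeasurableSet B) (hC : MeasurableSet C) :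
    ∫⁻ x in A, conv2 n (B.indicator 1) (C.indicator 1) x = addTriple A B C := by
  rw [addTriple_eq_setLIntegral hA hB hC]
  refine lintegral_congr fun x => ?_
  have hm : MeasurableSet {y | y ∈ B ∧ x - y ∈ C} :=
    hB.inter (measurable_const.sub measurable_id hC)
  rw [← lintegral_indicator_one hm]
  refine lintegral_congr fun y => ?_
  by_cases h1 : y ∈ B <;> by_cases h2 : x - y ∈ C <;> simp [indicator, h1, h2]

lemma setLIntegral_conv2_eq_addTriple {S U : ℝ → Set (EuclideanSpace ℝ (Fin n))}
    (hA : MeasurableSet A) (hf : IsLayered f S) (hg : IsLayered g U) :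
    ∫⁻ x in A, conv2 n f g x =
      ∫⁻ s in Ioi (0 : ℝ), ∫⁻ t in Ioi (0 : ℝ), addTriple A (S s) (U t) := by
  rw [hf.setLIntegral_conv2 hg.measurable]
  refine lintegral_congr fun s => ?_
  have hs := hf.measurableSet_layer s
  rw [conv2_comm, hg.setLIntegral_conv2 (measurable_one.indicator hs)]
  refine lintegral_congr fun t => ?_
  rw [conv2_comm, setLIntegral_conv2_indicator hA hs (hg.measurableSet_layer t)]

/-- The Riesz rearrangement inequality. -/
lemma setLIntegral_conv2_le (hf : Measurable f) (hg : Measurable g) (hA : MeasurableSet A) :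
    ∫⁻ x in A, conv2 n f g x ≤
      ∫⁻ x in ballRearrange n A, conv2 n (symmRearr n f) (symmRearr n g) x := by
  have hf' := isLayered_superlevel hf
  have hg' := isLayered_superlevel hg
  rw [setLIntegral_conv2_eq_addTriple hA hf' hg', setLIntegral_conv2_eq_addTriple
    measurableSet_ballRearrange isLayered_symmRearr isLayered_symmRearr]
  exact lintegral_mono fun s => lintegral_mono fun t => addTriple_le_ballRearrange hA
    (hf'.measurableSet_layer s) (hg'.measurableSet_layer t)

lemma ENNReal.mul_add_mul_le_mul_add_mul' {a b c d : ℝ≥0∞} (hba : b ≤ a) (hdc : d ≤ c) :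
    a * d + b * c ≤ a * c + b * d := by
  obtain ⟨e, rfl⟩ := exists_add_of_le hdc
  calc a * d + b * (d + e) = a * d + b * d + b * e := by ring
    _ ≤ a * d + b * d + a * e := by gcongr
    _ = a * (d + e) + b * d := by ring

lemma exists_reflection_swap {x x' : EuclideanSpace ℝ (Fin n)} (h : ‖x‖ ≤ ‖x'‖) :
    ∃ σ : EuclideanSpace ℝ (Fin n) → EuclideanSpace ℝ (Fin n), MeasurePreserving σ ∧
      (∀ z, ‖x - σ z‖ = ‖x' - z‖ ∧ ‖x' - σ z‖ = ‖x - z‖) ∧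
      ∀ z, ‖z‖ ≤ ‖σ z‖ ∧ ‖x - z‖ ≤ ‖x' - z‖ ∨ ‖σ z‖ ≤ ‖z‖ ∧ ‖x' - z‖ ≤ ‖x - z‖ := by
  set v := x - x' with hv
  set m := (2⁻¹ : ℝ) • (x + x') with hm
  set ρ := (ℝ ∙ v)ᗮ.reflection with hρ
  have hρv : ρ v = -v := Submodule.reflection_orthogonalComplement_singleton_eq_neg v
  have hx : x - m = (2⁻¹ : ℝ) • v := by rw [hv, hm]; module
  have hx' : x' - m = -((2⁻¹ : ℝ) • v) := by rw [hv, hm]; module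
  have hρx : ρ (x - m) = x' - m := by rw [hx, hx', map_smul, hρv, smul_neg]
  have hρx' : ρ (x' - m) = x - m := by rw [← hρx]; exact Submodule.reflection_reflection _ _
  have h1 : ∀ z, ‖x - (ρ (z - m) + m)‖ = ‖x' - z‖ := fun z => by
    have : ρ (x' - z) = x - (ρ (z - m) + m) := by
      rw [← sub_sub_sub_cancel_right x' z m, map_sub ρ (x' - m), hρx', sub_sub, add_comm]
    rw [← this, ρ.norm_map]
  have h2 : ∀ z, ‖x' - (ρ (z - m) + m)‖ = ‖x - z‖ := fun z => by
    have : ρ (x - z) = x' - (ρ (z - m) + m) := by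
      rw [← sub_sub_sub_cancel_right x z m, map_sub ρ (x - m), hρx, sub_sub, add_comm]
    rw [← this, ρ.norm_map]
  refine ⟨fun z => ρ (z - m) + m, ?_, fun z => ⟨h1 z, h2 z⟩, fun z => ?_⟩
  · exact (measurePreserving_add_right volume m).comp
      (ρ.measurePreserving.comp (measurePreserving_sub_right volume m))
  · set c := 2 * (inner ℝ v (z - m) / ‖v‖ ^ 2) with hc
    have hσ : ρ (z - m) + m = z - c • v := by
      rw [hρ, Submodule.reflection_orthogonal_apply, Submodule.reflection_singleton_apply, hc]
      simp only [RCLike.ofReal_real_eq_id, id]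
      module
    have hcv : c * ‖v‖ ^ 2 = 2 * inner ℝ v (z - m) := by
      by_cases hv0 : ‖v‖ = 0
      · simp [norm_eq_zero.1 hv0]
      · rw [hc]; field_simp
    have hnorm : ‖z - c • v‖ ^ 2 = ‖z‖ ^ 2 + c * (‖x'‖ ^ 2 - ‖x‖ ^ 2) := by
      have h3 : inner ℝ v m = 2⁻¹ * (‖x‖ ^ 2 - ‖x'‖ ^ 2) := by
        rw [hv, hm, inner_smul_right, inner_sub_left, inner_add_right, inner_add_right,
          real_inner_self_eq_norm_sq, real_inner_self_eq_norm_sq, real_inner_comm x x']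
        ring
      rw [inner_sub_right, h3] at hcv
      rw [norm_sub_sq_real, inner_smul_right, norm_smul, mul_pow, Real.norm_eq_abs, sq_abs,
        real_inner_comm]
      linear_combination c * hcv
    have hdist : ‖x' - z‖ ^ 2 - ‖x - z‖ ^ 2 = c * ‖v‖ ^ 2 := by
      have e1 : x - z = (2⁻¹ : ℝ) • v - (z - m) := by rw [← hx]; abel
      have e2 : x' - z = -((2⁻¹ : ℝ) • v + (z - m)) := by
        rw [neg_add, ← hx']; abel
      rw [hcv, e1, e2, norm_neg, norm_add_sq_real,
        norm_sub_sq_real (_ • v), real_inner_smul_left]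
      ring
    have hsq : ‖x‖ ^ 2 ≤ ‖x'‖ ^ 2 := by gcongr
    simp only [hσ]
    rcases le_total 0 c with hc0 | hc0
    · left
      constructor <;> refine le_of_sq_le_sq ?_ (norm_nonneg _)
      · nlinarith
      · nlinarith [sq_nonneg ‖v‖]
    · right
      constructor <;> refine le_of_sq_le_sq ?_ (norm_nonneg _)
      · nlinarith
      · nlinarith [sq_nonneg ‖v‖]

lemma IsRadiallyDecreasing.conv2 (hf : IsRadiallyDecreasing f) (hg : IsRadiallyDecreasing g)
    (hfm : Measurable f) (hgm : Measurable g) : IsRadiallyDecreasing (conv2 n f g) := by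
  intro x x' hxx'
  obtain ⟨σ, hσ, hσx, hz⟩ := exists_reflection_swap hxx'
  have hdouble : ∀ w, 2 * _root_.conv2 n f g w =
      ∫⁻ z, (f z * g (w - z) + f (σ z) * g (w - σ z)) := fun w => by
    have hm : Measurable fun z => f z * g (w - z) := by fun_prop
    rw [lintegral_add_left hm, hσ.lintegral_comp hm, two_mul]
    rfl
  refine (ENNReal.mul_le_mul_iff_right two_ne_zero ofNat_ne_top).1 ?_
  rw [hdouble, hdouble]
  refine lintegral_mono fun z => ?_
  have e1 : g (x - σ z) = g (x' - z) :=
    le_antisymm (hg (hσx z).1.ge) (hg (hσx z).1.le)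
  have e2 : g (x' - σ z) = g (x - z) :=
    le_antisymm (hg (hσx z).2.ge) (hg (hσx z).2.le)
  rw [e1, e2]
  rcases hz z with h | h
  · exact ENNReal.mul_add_mul_le_mul_add_mul' (hf h.1) (hg h.2)
  · rw [add_comm, add_comm (f z * _)]
    exact ENNReal.mul_add_mul_le_mul_add_mul' (hf h.1) (hg h.2)

/-- The integral of `F` over any set is at most that of `G` over the rearranged set. -/
def RearrDominated (F G : EuclideanSpace ℝ (Fin n) → ℝ≥0∞) : Prop :=
  ∀ ⦃A⦄, MeasurableSet A → ∫⁻ x in A, F x ≤ ∫⁻ x in ballRearrange n A, G x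

lemma volume_ballRearrange (hA : volume A ≠ ⊤) : volume (ballRearrange n A) = volume A := by
  obtain ⟨r, h1, h2⟩ := exists_ballRearrange_eq_ball hA
  rw [h1, h2]

lemma volume_inter_le_ballRearrange (hA : volume A ≠ ⊤) :
    volume (A ∩ B) ≤ volume (ballRearrange n A ∩ ballRearrange n B) := by
  rcases le_total (volume A) (volume B) with h | h
  · rw [inter_eq_self_of_subset_left (ballRearrange_subset h), volume_ballRearrange hA]
    exact measure_mono inter_subset_left
  · rw [inter_eq_self_of_subset_right (ballRearrange_subset h),
      volume_ballRearrange (ne_top_of_le_ne_top hA h)]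
    exact measure_mono inter_subset_right

lemma rearrDominated_symmRearr (hf : Measurable f) (hfin : ∫⁻ x, f x ≠ ⊤) :
    RearrDominated f (symmRearr n f) := by
  intro A _
  rw [(isLayered_superlevel hf).setLIntegral, isLayered_symmRearr.setLIntegral]
  refine setLIntegral_mono' measurableSet_Ioi fun t ht => volume_inter_le_ballRearrange ?_
  have h0 : ENNReal.ofReal t ≠ 0 := (ENNReal.ofReal_pos.2 ht).ne'
  refine ne_top_of_le_ne_top (ENNReal.div_ne_top hfin h0) ?_
  exact (measure_mono (ofPred_subset_ofPred.2 fun x hx => le_of_lt hx)).trans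
    (meas_ge_le_lintegral_div hf.aemeasurable h0 ENNReal.ofReal_ne_top)

lemma RearrDominated.lintegral_tsub_le (h : RearrDominated F G) (hF : Measurable F)
    (hfin : ∫⁻ x, F x ≠ ⊤) (τ : ℝ≥0∞) : ∫⁻ x, (F x - τ) ≤ ∫⁻ x, (G x - τ) := by
  set A := {x | τ < F x} with hA_def
  have hA : MeasurableSet A := measurableSet_lt measurable_const hF
  have hle : ∀ x ∈ A, τ ≤ F x := fun x hx => le_of_lt hx
  have h1 : ∫⁻ x, (F x - τ) = ∫⁻ x in A, (F x - τ) := by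
    refine (setLIntegral_eq_of_support_subset fun x hx => ?_).symm
    exact tsub_pos_iff_lt.1 (pos_iff_ne_zero.2 hx)
  have h2 : ∫⁻ x in A, F x = (∫⁻ x in A, (F x - τ)) + τ * volume A := by
    rw [← setLIntegral_const, ← lintegral_add_right _ measurable_const]
    exact setLIntegral_congr_fun hA fun x hx => (tsub_add_cancel_of_le (hle x hx)).symm
  have h3 : τ * volume A ≠ ⊤ := by
    refine ne_top_of_le_ne_top hfin (le_trans ?_ (setLIntegral_le_lintegral A F))
    rw [h2]; exact le_add_self
  have h4 : ∫⁻ x in ballRearrange n A, G x ≤ (∫⁻ x, (G x - τ)) + τ * volume A := by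
    calc ∫⁻ x in ballRearrange n A, G x
        ≤ ∫⁻ x in ballRearrange n A, ((G x - τ) + τ) := lintegral_mono fun x => le_tsub_add
      _ = (∫⁻ x in ballRearrange n A, (G x - τ)) + τ * volume (ballRearrange n A) := by
          rw [lintegral_add_right _ measurable_const, setLIntegral_const]
      _ ≤ _ := by
          exact add_le_add (setLIntegral_le_lintegral _ _)
            (mul_le_mul_right volume_ballRearrange_le _)
  rw [h1]
  refine (ENNReal.add_le_add_iff_right h3).1 ?_
  rw [← h2]
  exact (h hA).trans h4

/-- Domination over the superlevel sets of radially decreasing functions. -/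
lemma RearrDominated.setLIntegral_symmRearr_le (h : RearrDominated F G) (hF : Measurable F)
    (hfin : ∫⁻ x, F x ≠ ⊤) (hG : IsRadiallyDecreasing G) (hB : MeasurableSet B)
    (hBn : ∀ ⦃x y⦄, ‖x‖ ≤ ‖y‖ → y ∈ B → x ∈ B) :
    ∫⁻ x in B, symmRearr n F x ≤ ∫⁻ x in B, G x := by
  rcases eq_or_ne (volume B) 0 with hB0 | hB0
  · rw [setLIntegral_measure_zero _ _ hB0]; exact zero_le
  set τ := ⨅ x ∈ B, G x
  have hτG : ∀ x ∈ B, τ ≤ G x := fun x hx => iInf₂_le x hx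
  have h1 : ∫⁻ x in B, G x = τ * volume B + ∫⁻ x, (G x - τ) := by
    have : ∫⁻ x, (G x - τ) = ∫⁻ x in B, (G x - τ) := by
      refine (setLIntegral_eq_of_support_subset fun y hy => ?_).symm
      by_contra hyB
      refine hy (tsub_eq_zero_of_le (le_iInf₂ fun x hx => hG ?_))
      by_contra hxy
      exact hyB (hBn (le_of_not_ge hxy) hx)
    rw [this, ← setLIntegral_const, ← lintegral_add_left measurable_const]
    exact setLIntegral_congr_fun hB fun x hx => (add_tsub_cancel_of_le (hτG x hx)).symm
  rw [h1]
  rcases eq_or_ne τ ⊤ with hτ | hτ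
  · rw [hτ, ENNReal.top_mul hB0, top_add]; exact le_top
  calc ∫⁻ x in B, symmRearr n F x
      = ∫⁻ t in Ioi (0 : ℝ), volume (ballRearrange n {x | ENNReal.ofReal t < F x} ∩ B) :=
        isLayered_symmRearr.setLIntegral B
    _ ≤ (∫⁻ t in Ioc 0 τ.toReal, volume B) +
          ∫⁻ t in Ioi τ.toReal, volume {x | ENNReal.ofReal t < F x} := by
        rw [← Ioc_union_Ioi_eq_Ioi toReal_nonneg]
        refine (lintegral_union_le _ _ _).trans ?_
        exact add_le_add (lintegral_mono fun t => measure_mono inter_subset_right)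
          (lintegral_mono fun t => (measure_mono inter_subset_left).trans volume_ballRearrange_le)
    _ = τ * volume B + ∫⁻ x, (F x - τ) := by
        rw [← _root_.lintegral_tsub_eq hF toReal_nonneg, setLIntegral_const, Real.volume_Ioc,
          sub_zero, ENNReal.ofReal_toReal hτ, mul_comm]
    _ ≤ _ := add_le_add_right (h.lintegral_tsub_le hF hfin τ) _

lemma RearrDominated.conv2 (h : RearrDominated F G) (hF : Measurable F) (hfin : ∫⁻ x, F x ≠ ⊤)
    (hGm : Measurable G) (hG : IsRadiallyDecreasing G) (hf : Measurable f) :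
    RearrDominated (conv2 n f F) (_root_.conv2 n (symmRearr n f) G) := by
  intro A hA
  refine (setLIntegral_conv2_le hf hF hA).trans ?_
  set f' := symmRearr n f
  have hf' : Measurable f' := isLayered_symmRearr.measurable
  have hf'r : IsRadiallyDecreasing f' := isRadiallyDecreasing_symmRearr
  have hF' : Measurable (symmRearr n F) := isLayered_symmRearr.measurable
  set a : EuclideanSpace ℝ (Fin n) → ℝ≥0∞ := (ballRearrange n A).indicator 1
  have ham : Measurable a := measurable_one.indicator measurableSet_ballRearrange
  set H := _root_.conv2 n a f'
  have hHm : Measurable H := measurable_conv2 ham hf'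
  have hH : IsRadiallyDecreasing H :=
    isRadiallyDecreasing_indicator_ballRearrange.conv2 hf'r ham hf'
  have key : ∀ g : EuclideanSpace ℝ (Fin n) → ℝ≥0∞, Measurable g →
      ∫⁻ x in ballRearrange n A, _root_.conv2 n f' g x =
        ∫⁻ t in Ioi (0 : ℝ), ∫⁻ z in {z | ENNReal.ofReal t < H z}, g z := fun g hg => by
    rw [conv2_comm, setLIntegral_conv2 hg hf', ← (isLayered_superlevel hHm).lintegral_mul hg]
    refine lintegral_congr fun z => ?_
    congr 1
    rw [← lintegral_indicator measurableSet_ballRearrange]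
    refine lintegral_congr fun x => ?_
    rw [← neg_sub x z, hf'r.neg_apply]
    by_cases hx : x ∈ ballRearrange n A <;> simp [a, hx]
  rw [key _ hF', key _ hGm]
  refine lintegral_mono fun t => h.setLIntegral_symmRearr_le hF hfin hG
    (measurableSet_lt measurable_const hHm) fun x y hxy hy => lt_of_lt_of_le hy (hH hxy)

lemma rearrDominated_convList : ∀ l : List (EuclideanSpace ℝ (Fin n) → ℝ≥0∞), l ≠ [] →
    (∀ f ∈ l, IsDensity n f) →
    IsDensity n (convList n l) ∧ Measurable (convList n (l.map (symmRearr n))) ∧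
      IsRadiallyDecreasing (convList n (l.map (symmRearr n))) ∧
      RearrDominated (convList n l) (convList n (l.map (symmRearr n)))
  | [], h, _ => absurd rfl h
  | [f], _, hd => by
    obtain ⟨hf, hf1⟩ := hd f (by simp)
    exact ⟨⟨hf, hf1⟩, isLayered_symmRearr.measurable, isRadiallyDecreasing_symmRearr,
      rearrDominated_symmRearr hf (hf1 ▸ one_ne_top)⟩
  | f :: g :: l, _, hd => by
    obtain ⟨hf, hf1⟩ := hd f (by simp)
    obtain ⟨⟨hF, hF1⟩, hGm, hG, hR⟩ := rearrDominated_convList (g :: l) (by simp)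
      fun k hk => hd k (List.mem_cons_of_mem _ hk)
    have hf' : Measurable (symmRearr n f) := isLayered_symmRearr.measurable
    refine ⟨⟨measurable_conv2 hf hF, ?_⟩, measurable_conv2 hf' hGm,
      isRadiallyDecreasing_symmRearr.conv2 hG hf' hGm, hR.conv2 hF (by simp [hF1]) hGm hG hf⟩
    exact (lintegral_conv2 hf hF).trans (by rw [hf1, hF1, one_mul])

end Rearrangement

section Moments

variable {α : Type*} [MeasurableSpace α] {μ : Measure α} {F G : α → ℝ≥0∞}

lemma rpow_mul_eq_lintegral_tsub {p : ℝ} (hp : 1 < p) (x : ℝ≥0∞) :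
    x ^ p * ENNReal.ofReal (1 / (p * (p - 1))) =
      ∫⁻ t in Ioi (0 : ℝ), (x - ENNReal.ofReal t) * ENNReal.ofReal (t ^ (p - 2)) := by
  have hp0 : 0 < p := one_pos.trans hp
  have hp1 : 0 < p - 1 := sub_pos.2 hp
  rcases eq_or_ne x ⊤ with rfl | hx
  · have h1 : ∫⁻ t in Ioi (0 : ℝ), (⊤ - ENNReal.ofReal t) * ENNReal.ofReal (t ^ (p - 2)) =
        ∫⁻ _ in Ioi (0 : ℝ), ⊤ := by
      refine setLIntegral_congr_fun measurableSet_Ioi fun t ht => ?_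
      rw [ENNReal.top_sub ENNReal.ofReal_ne_top, ENNReal.top_mul]
      exact (ENNReal.ofReal_pos.2 (Real.rpow_pos_of_pos ht _)).ne'
    rw [h1, ENNReal.top_rpow_of_pos hp0, ENNReal.top_mul, setLIntegral_const, Real.volume_Ioi,
      ENNReal.top_mul_top]
    exact (ENNReal.ofReal_pos.2 (by positivity)).ne'
  lift x to NNReal using hx
  have hint1 : IntervalIntegrable (fun t : ℝ => t ^ (p - 2)) volume 0 x :=
    intervalIntegral.intervalIntegrable_rpow' (by linarith)
  have hint2 : IntervalIntegrable (fun t : ℝ => t ^ (p - 1)) volume 0 x :=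
    intervalIntegral.intervalIntegrable_rpow' (by linarith)
  have hx0 : (0 : ℝ) ≤ x := x.2
  set φ : ℝ → ℝ := fun t => x * t ^ (p - 2) - t ^ (p - 1)
  have hφ : ∀ t : ℝ, 0 < t → φ t = (x - t) * t ^ (p - 2) := fun t ht => by
    have : t ^ (p - 1) = t * t ^ (p - 2) := by
      rw [show p - 1 = 1 + (p - 2) by ring, Real.rpow_add ht, Real.rpow_one]
    simp only [φ]
    rw [this]; ring
  have h1 : ∫⁻ t in Ioi (0 : ℝ), ((x : ℝ≥0∞) - ENNReal.ofReal t) * ENNReal.ofReal (t ^ (p - 2)) =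
      ∫⁻ t in Ioc (0 : ℝ) x, ENNReal.ofReal (φ t) := by
    have h2 : ∀ t : ℝ, 0 < t → ((x : ℝ≥0∞) - ENNReal.ofReal t) * ENNReal.ofReal (t ^ (p - 2)) =
        ENNReal.ofReal (φ t) := fun t ht => by
      rw [hφ t ht, ENNReal.ofReal_mul' (by positivity), ENNReal.ofReal_sub _ ht.le,
        ENNReal.ofReal_coe_nnreal]
    have h4 : ∫⁻ t in Ioi (x : ℝ), ENNReal.ofReal (φ t) = 0 := by
      rw [setLIntegral_congr_fun measurableSet_Ioi (g := 0) fun t ht => ?_, Pi.zero_def,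
        lintegral_zero]
      have ht0 : 0 < t := hx0.trans_lt ht
      rw [Pi.zero_apply, ENNReal.ofReal_eq_zero, hφ t ht0]
      exact mul_nonpos_of_nonpos_of_nonneg (sub_nonpos.2 (le_of_lt ht)) (by positivity)
    rw [setLIntegral_congr_fun measurableSet_Ioi h2, ← Ioc_union_Ioi_eq_Ioi hx0,
      lintegral_union measurableSet_Ioi (Ioc_disjoint_Ioi le_rfl), h4, add_zero]
  have h3 : ∫ t in (0 : ℝ)..x, φ t = (x : ℝ) ^ p * (1 / (p * (p - 1))) := by
    simp only [φ]
    rw [intervalIntegral.integral_sub (hint1.const_mul _) hint2,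
      intervalIntegral.integral_const_mul, integral_rpow (Or.inl (by linarith)),
      integral_rpow (Or.inl (by linarith))]
    have e1 : p - 2 + 1 = p - 1 := by ring
    have e2 : p - 1 + 1 = p := by ring
    have e3 : (x : ℝ) * x ^ (p - 1) = x ^ p := by
      rcases hx0.eq_or_lt with h | h
      · rw [← h, Real.zero_rpow hp0.ne', zero_mul]
      · rw [Real.rpow_sub_one h.ne']; field_simp
    rw [e1, e2, Real.zero_rpow hp1.ne', Real.zero_rpow hp0.ne', sub_zero, sub_zero, ← mul_div_assoc,
      e3]
    field_simp
    ring
  rw [h1, ← ofReal_integral_eq_lintegral_ofReal, ← intervalIntegral.integral_of_le hx0, h3,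
    ENNReal.ofReal_mul (by positivity), ← ENNReal.ofReal_coe_nnreal,
    ENNReal.ofReal_rpow_of_nonneg hx0 hp0.le]
  · exact ((intervalIntegrable_iff_integrableOn_Ioc_of_le hx0).1 ((hint1.const_mul _).sub hint2))
  · refine (ae_restrict_iff' measurableSet_Ioc).2 (ae_of_all _ fun t ht => ?_)
    rw [hφ t ht.1]
    exact mul_nonneg (sub_nonneg.2 ht.2) (Real.rpow_nonneg ht.1.le _)

lemma lintegral_rpow_le_of_lintegral_tsub_le [SFinite μ] (hF : Measurable F) (hG : Measurable G)
    (h : ∀ τ : ℝ≥0∞, ∫⁻ x, (F x - τ) ∂μ ≤ ∫⁻ x, (G x - τ) ∂μ) {p : ℝ} (hp : 1 < p) :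
    ∫⁻ x, F x ^ p ∂μ ≤ ∫⁻ x, G x ^ p ∂μ := by
  have key : ∀ K : α → ℝ≥0∞, Measurable K →
      (∫⁻ x, K x ^ p ∂μ) * ENNReal.ofReal (1 / (p * (p - 1))) =
        ∫⁻ t in Ioi (0 : ℝ),
          (∫⁻ x, (K x - ENNReal.ofReal t) ∂μ) * ENNReal.ofReal (t ^ (p - 2)) := by
    intro K hK
    rw [← lintegral_mul_const _ (hK.pow_const p)]
    simp_rw [rpow_mul_eq_lintegral_tsub hp]
    rw [lintegral_lintegral_swap]
    · exact lintegral_congr fun t => lintegral_mul_const _ (hK.sub measurable_const)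
    · exact Measurable.aemeasurable (by fun_prop)
  have hc : 0 < 1 / (p * (p - 1)) :=
    one_div_pos.2 (mul_pos (one_pos.trans hp) (sub_pos.2 hp))
  refine (ENNReal.mul_le_mul_iff_left (ENNReal.ofReal_pos.2 hc).ne' ENNReal.ofReal_ne_top).1 ?_
  rw [key F hF, key G hG]
  exact lintegral_mono fun t => mul_le_mul_left (h _) _

lemma essSup_le_of_lintegral_tsub_le (hF : Measurable F)
    (h : ∀ τ : ℝ≥0∞, ∫⁻ x, (F x - τ) ∂μ ≤ ∫⁻ x, (G x - τ) ∂μ) : essSup F μ ≤ essSup G μ := by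
  have hG0 : ∫⁻ x, (G x - essSup G μ) ∂μ = 0 := by
    rw [← lintegral_zero (μ := μ)]
    refine lintegral_congr_ae ?_
    filter_upwards [ENNReal.ae_le_essSup G] with x hx using tsub_eq_zero_of_le hx
  have hF0 := nonpos_iff_eq_zero.1 ((h (essSup G μ)).trans hG0.le)
  replace hF0 := (lintegral_eq_zero_iff (hF.sub measurable_const)).1 hF0
  refine essSup_le_of_ae_le _ ?_
  filter_upwards [hF0] with x hx using tsub_eq_zero_iff_le.1 hx

end Moments

/-- Main Theorem, Lᵖ version: for probability densities `f₁,…,f_k` on `ℝⁿ` and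
`p ∈ (1,∞]`, `‖f₁ ⋆ ⋯ ⋆ f_k‖_p ≤ ‖f₁* ⋆ ⋯ ⋆ f_k*‖_p`; equivalently
`h_p(f₁ ⋆ ⋯ ⋆ f_k) ≥ h_p(f₁* ⋆ ⋯ ⋆ f_k*)` (for `p = ∞`, `‖·‖_∞` is the
essential supremum and `h_∞ = -log ‖·‖_∞`). -/
theorem lpNorm_convList_symmRearr (n : ℕ)
    (l : List (EuclideanSpace ℝ (Fin n) → ℝ≥0∞)) (hl : l ≠ [])
    (hd : ∀ f ∈ l, IsDensity n f) :
    (∀ p : ℝ, 1 < p →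
      (∫⁻ x, convList n l x ^ p) ^ (1 / p) ≤
        (∫⁻ x, convList n (l.map (symmRearr n)) x ^ p) ^ (1 / p)) ∧
    essSup (convList n l) volume ≤ essSup (convList n (l.map (symmRearr n))) volume ∧
    (∀ p : ℝ, 1 < p →
      renyi n (convList n (l.map (symmRearr n))) p ≤ renyi n (convList n l) p) ∧
    -ENNReal.log (essSup (convList n (l.map (symmRearr n))) volume) ≤
      -ENNReal.log (essSup (convList n l) volume) := by
  obtain ⟨hF, hGm, -, hR⟩ := rearrDominated_convList l hl hd
  have hle := hR.lintegral_tsub_le hF.1 (hF.2 ▸ one_ne_top)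
  have hp := fun p (hp : 1 < p) => lintegral_rpow_le_of_lintegral_tsub_le hF.1 hGm hle (p := p) hp
  have hsup := essSup_le_of_lintegral_tsub_le hF.1 hle
  refine ⟨fun p h1 => ENNReal.rpow_le_rpow (hp p h1) (by positivity), hsup, fun p h1 => ?_, ?_⟩
  · have hneg : (((1 - p)⁻¹ : ℝ) : EReal) ≤ 0 :=
      EReal.coe_nonpos.2 (inv_nonpos.2 (by linarith))
    exact (mul_comm _ _).trans_le ((EReal.mul_le_mul_of_nonpos_right
      (ENNReal.log_monotone (hp p h1)) hneg).trans_eq (mul_comm _ _))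
  · exact EReal.neg_le_neg_iff.2 (ENNReal.log_monotone hsup)
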